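/- arXiv:1005.4090 — 2 statements merged into one kernel-verified Lean document; each statement's English description precedes it below -/
import Mathlib

section
/- (Folland–Kaplan) Assume the data is of Heisenberg type. Then there exists a constant c > 0 such that Γ(g) = −c · N(g)^{2−Q} is a fundamental solution of the horizontal Laplacian with pole at the identity: for every smooth compactly supported function φ : G → ℝ, ∫_G Γ(g) 𝓛φ(g) dg = φ(e), i.e. ∫_G N(g)^{2−Q} 𝓛φ(g) dg = −c⁻¹ φ(0,0). -/
open scoped RealInnerProductSpace
open MeasureTheory

noncomputable section

variable {V₁ V₂ : Type*} [NormedAddCommGroup V₁] [InnerProductSpace ℝ V₁]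
  [NormedAddCommGroup V₂] [InnerProductSpace ℝ V₂]

/-- The horizontal derivative of `f : V₁ × V₂ → ℝ` at `g = (z,t)` in the horizontal
direction `v ∈ V₁`, namely `Df(g)(v, ½[z,v])`. -/
def Xd (b : V₁ →ₗ[ℝ] V₁ →ₗ[ℝ] V₂) (v : V₁) (f : V₁ × V₂ → ℝ) (g : V₁ × V₂) : ℝ :=
  fderiv ℝ f g (v, (2⁻¹ : ℝ) • b g.1 v)

/-- The horizontal gradient: the unique vector of `V₁` representing the linear functional
`v ↦ X_v f (g)` via the inner product of `V₁`. -/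
def Xgrad [FiniteDimensional ℝ V₁] [FiniteDimensional ℝ V₂]
    (b : V₁ →ₗ[ℝ] V₁ →ₗ[ℝ] V₂) (f : V₁ × V₂ → ℝ) (g : V₁ × V₂) : V₁ :=
  (InnerProductSpace.toDual ℝ V₁).symm
    (LinearMap.toContinuousLinearMap
      ((fderiv ℝ f g).toLinearMap.comp
        (LinearMap.prod LinearMap.id ((2⁻¹ : ℝ) • b g.1))))

/-- The symmetrized second horizontal derivative `f_{,uv} = ½(X_u X_v f + X_v X_u f)`. -/
def X2sym (b : V₁ →ₗ[ℝ] V₁ →ₗ[ℝ] V₂) (u v : V₁) (f : V₁ × V₂ → ℝ) (g : V₁ × V₂) : ℝ :=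
  (Xd b u (Xd b v f) g + Xd b v (Xd b u f) g) / 2

/-- The horizontal (sub-)Laplacian `𝓛 f = Σᵢ X_{eᵢ} X_{eᵢ} f`. -/
def hLap [FiniteDimensional ℝ V₁] (b : V₁ →ₗ[ℝ] V₁ →ₗ[ℝ] V₂) (f : V₁ × V₂ → ℝ)
    (g : V₁ × V₂) : ℝ :=
  ∑ i, Xd b (stdOrthonormalBasis ℝ V₁ i) (Xd b (stdOrthonormalBasis ℝ V₁ i) f) g

/-- The horizontal ∞-Laplacian `𝓛_∞ f = Σ_{i,j} f_{,eᵢeⱼ} X_{eᵢ}f X_{eⱼ}f`. -/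
def hInfLap [FiniteDimensional ℝ V₁] (b : V₁ →ₗ[ℝ] V₁ →ₗ[ℝ] V₂) (f : V₁ × V₂ → ℝ)
    (g : V₁ × V₂) : ℝ :=
  ∑ i, ∑ j, X2sym b (stdOrthonormalBasis ℝ V₁ i) (stdOrthonormalBasis ℝ V₁ j) f g *
    Xd b (stdOrthonormalBasis ℝ V₁ i) f g * Xd b (stdOrthonormalBasis ℝ V₁ j) f g

/-- `ψ(z,t) = |z|²`. -/
def psiF (g : V₁ × V₂) : ℝ := ‖g.1‖ ^ 2

/-- `χ(z,t) = |t|²`. -/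
def chiF (g : V₁ × V₂) : ℝ := ‖g.2‖ ^ 2

/-- `a(z,t) = ψ² + 16χ = |z|⁴ + 16|t|²`. -/
def aF (g : V₁ × V₂) : ℝ := psiF g ^ 2 + 16 * chiF g

/-- The Folland–Kaplan gauge `N = a^{1/4}`. -/
def Ng (g : V₁ × V₂) : ℝ := aF g ^ ((1 : ℝ) / 4)

/-- `A(z,t) = |z|² z + 4 J(t) z`. -/
def Ag (J : V₂ → V₁ →ₗ[ℝ] V₁) (g : V₁ × V₂) : V₁ :=
  ‖g.1‖ ^ 2 • g.1 + (4 : ℝ) • J g.2 g.1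

/-- The group law `(z,t)·(z',t') = (z+z', t+t'+½[z,z'])`. -/
def gmul (b : V₁ →ₗ[ℝ] V₁ →ₗ[ℝ] V₂) (g h : V₁ × V₂) : V₁ × V₂ :=
  (g.1 + h.1, g.2 + h.2 + (2⁻¹ : ℝ) • b g.1 h.1)

/-- The group inverse `(z,t)⁻¹ = (−z,−t)`. -/
def ginv (g : V₁ × V₂) : V₁ × V₂ := (-g.1, -g.2)

end

section helpers

set_option linter.unusedSectionVars false

variable {V₁ V₂ : Type*} [NormedAddCommGroup V₁] [InnerProductSpace ℝ V₁]
  [FiniteDimensional ℝ V₁] [NormedAddCommGroup V₂] [InnerProductSpace ℝ V₂]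
  [FiniteDimensional ℝ V₂]

theorem hk_bcont (b : V₁ →ₗ[ℝ] V₁ →ₗ[ℝ] V₂) (v : V₁) :
    ContDiff ℝ (⊤ : ℕ∞) (fun g : V₁ × V₂ => b g.1 v) :=
  ContDiff.comp (g := fun z => LinearMap.toContinuousLinearMap (b.flip v) z)
    (LinearMap.toContinuousLinearMap (b.flip v)).contDiff contDiff_fst

theorem hk_Xd_contDiff (b : V₁ →ₗ[ℝ] V₁ →ₗ[ℝ] V₂) (v : V₁) {f : V₁ × V₂ → ℝ}
    (hf : ContDiff ℝ (⊤ : ℕ∞) f) : ContDiff ℝ (⊤ : ℕ∞) (Xd b v f) := by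
  unfold Xd
  have h1 : ContDiff ℝ (⊤ : ℕ∞) (fderiv ℝ f) := hf.fderiv_right (by simp)
  exact h1.clm_apply (contDiff_const.prodMk (contDiff_const.smul (hk_bcont b v)))

theorem hk_Xd_compact (b : V₁ →ₗ[ℝ] V₁ →ₗ[ℝ] V₂) (v : V₁) {f : V₁ × V₂ → ℝ}
    (hf : HasCompactSupport f) : HasCompactSupport (Xd b v f) := by
  refine (hf.fderiv (𝕜 := ℝ)).mono ?_
  intro x hx
  simp only [Function.mem_support, Xd] at hx ⊢
  intro h
  simp [h] at hx

theorem hk_Xd_mul (b : V₁ →ₗ[ℝ] V₁ →ₗ[ℝ] V₂) (v : V₁) {f h : V₁ × V₂ → ℝ} {g : V₁ × V₂}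
    (hf : DifferentiableAt ℝ f g) (hh : DifferentiableAt ℝ h g) :
    Xd b v (fun x => f x * h x) g = f g * Xd b v h g + Xd b v f g * h g := by
  simp only [Xd]
  rw [fderiv_fun_mul hf hh]
  simp; ring

theorem hk_Xd_sub (b : V₁ →ₗ[ℝ] V₁ →ₗ[ℝ] V₂) (v : V₁) {f h : V₁ × V₂ → ℝ} {g : V₁ × V₂}
    (hf : DifferentiableAt ℝ f g) (hh : DifferentiableAt ℝ h g) :
    Xd b v (fun x => f x - h x) g = Xd b v f g - Xd b v h g := by
  simp only [Xd]
  rw [fderiv_fun_sub hf hh]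
  simp

theorem hk_Xd_rpow (b : V₁ →ₗ[ℝ] V₁ →ₗ[ℝ] V₂) (v : V₁) {f : V₁ × V₂ → ℝ} {g : V₁ × V₂}
    (hf : DifferentiableAt ℝ f g) (p : ℝ) (h0 : f g ≠ 0) :
    Xd b v (fun x => f x ^ p) g = p * f g ^ (p - 1) * Xd b v f g := by
  simp only [Xd]
  rw [(hf.hasFDerivAt.rpow_const (Or.inl h0)).fderiv]
  simp

section meas
variable [MeasurableSpace V₁] [BorelSpace V₁] [MeasurableSpace V₂] [BorelSpace V₂]

theorem hk_haar : (volume : Measure (V₁ × V₂)).IsAddHaarMeasure :=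
  inferInstanceAs ((volume : Measure V₁).prod (volume : Measure V₂)).IsAddHaarMeasure

theorem hk_integral_coef (v : V₁ × V₂) {c h : V₁ × V₂ → ℝ}
    (hc : ContDiff ℝ (⊤ : ℕ∞) c) (hc0 : ∀ g, fderiv ℝ c g v = 0)
    (hh : ContDiff ℝ (⊤ : ℕ∞) h) (hs : HasCompactSupport h) :
    Integrable (fun g => c g * fderiv ℝ h g v) ∧ ∫ g, c g * fderiv ℝ h g v = 0 := by
  have h1 : ContDiff ℝ (⊤ : ℕ∞) (fderiv ℝ h) := hh.fderiv_right (by simp)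
  have h2 : Continuous (fun g => fderiv ℝ h g v) := (h1.clm_apply contDiff_const).continuous
  have h3 : HasCompactSupport (fun g => fderiv ℝ h g v) := by
    refine (hs.fderiv (𝕜 := ℝ)).mono ?_
    intro x hx
    simp only [Function.mem_support] at hx ⊢
    intro h
    simp [h] at hx
  have hi : Integrable (fun g => c g * fderiv ℝ h g v) :=
    (hc.continuous.mul h2).integrable_of_hasCompactSupport h3.mul_left
  refine ⟨hi, ?_⟩
  have := hk_haar (V₁ := V₁) (V₂ := V₂)
  rw [integral_mul_fderiv_eq_neg_fderiv_mul_of_integrable]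
  · simp [hc0]
  · simp [hc0]
  · exact hi
  · exact (hc.continuous.mul hh.continuous).integrable_of_hasCompactSupport hs.mul_left
  · exact fun x _ => (hc.differentiable (by simp)).differentiableAt
  · exact fun x _ => (hh.differentiable (by simp)).differentiableAt

theorem hk_integral_Xd (b : V₁ →ₗ[ℝ] V₁ →ₗ[ℝ] V₂) (v : V₁) {h : V₁ × V₂ → ℝ}
    (hh : ContDiff ℝ (⊤ : ℕ∞) h) (hs : HasCompactSupport h) :
    ∫ g, Xd b v h g = 0 := by
  let T := stdOrthonormalBasis ℝ V₂
  have key : ∀ g, Xd b v h g = (1 : ℝ) * fderiv ℝ h g (v, 0) +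
      ∑ j, (2⁻¹ * ⟪T j, b g.1 v⟫) * fderiv ℝ h g (0, T j) := by
    intro g
    have e : ((v, (2⁻¹ : ℝ) • b g.1 v) : V₁ × V₂) =
        (v, 0) + ∑ j, (2⁻¹ * ⟪T j, b g.1 v⟫) • ((0, T j) : V₁ × V₂) := by
      have : ∑ j, (2⁻¹ * ⟪T j, b g.1 v⟫) • ((0, T j) : V₁ × V₂) =
          ContinuousLinearMap.inr ℝ V₁ V₂ ((2⁻¹ : ℝ) • b g.1 v) := by
        conv_rhs => rw [← T.sum_repr' (b g.1 v)]
        rw [Finset.smul_sum, map_sum]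
        refine Finset.sum_congr rfl fun j _ => ?_
        simp [smul_smul]
      rw [this]; simp
    rw [Xd, e, map_add, map_sum, one_mul]
    simp only [map_smul, smul_eq_mul]
  simp_rw [key]
  have h1 := hk_integral_coef ((v, 0) : V₁ × V₂) (c := fun _ => 1) contDiff_const
    (by simp) hh hs
  have h2 : ∀ j, _ := fun j => hk_integral_coef ((0, T j) : V₁ × V₂)
    (c := fun g => 2⁻¹ * ⟪T j, b g.1 v⟫)
    (contDiff_const.mul (contDiff_const.inner ℝ (hk_bcont b v)))
    (by
      intro g
      have hd : DifferentiableAt ℝ (fun g : V₁ × V₂ => 2⁻¹ * ⟪T j, b g.1 v⟫) g :=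
        (contDiff_const.mul (contDiff_const.inner ℝ (hk_bcont b v))).differentiable
          (n := (⊤ : ℕ∞)) (by simp) |>.differentiableAt
      rw [← hd.lineDeriv_eq_fderiv]
      simp [lineDeriv]) hh hs
  rw [integral_add h1.1 (integrable_finsetSum _ fun j _ => (h2 j).1), h1.2,
    integral_finsetSum _ fun j _ => (h2 j).1]
  simp [(h2 _).2]

theorem hk_symm (b : V₁ →ₗ[ℝ] V₁ →ₗ[ℝ] V₂) {f φ : V₁ × V₂ → ℝ}
    (hf : ContDiff ℝ (⊤ : ℕ∞) f) (hφ : ContDiff ℝ (⊤ : ℕ∞) φ) (hs : HasCompactSupport φ) :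
    ∫ g, f g * hLap b φ g = ∫ g, hLap b f g * φ g := by
  have dd : ∀ {u : V₁ × V₂ → ℝ}, ContDiff ℝ (⊤ : ℕ∞) u → ∀ g, DifferentiableAt ℝ u g :=
    fun hu g => (hu.differentiable (by simp)).differentiableAt
  have h1 : ∀ v, Integrable (fun g => f g * Xd b v (Xd b v φ) g) := fun v =>
    (hf.continuous.mul (hk_Xd_contDiff b v (hk_Xd_contDiff b v hφ)).continuous).integrable_of_hasCompactSupport
      (hk_Xd_compact b v (hk_Xd_compact b v hs)).mul_left
  have h2 : ∀ v, Integrable (fun g => Xd b v (Xd b v f) g * φ g) := fun v =>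
    ((hk_Xd_contDiff b v (hk_Xd_contDiff b v hf)).continuous.mul hφ.continuous).integrable_of_hasCompactSupport
      hs.mul_left
  simp only [hLap, Finset.mul_sum, Finset.sum_mul]
  rw [integral_finsetSum _ fun i _ => h1 _, integral_finsetSum _ fun i _ => h2 _]
  refine Finset.sum_congr rfl fun i _ => ?_
  generalize (stdOrthonormalBasis ℝ V₁) i = v
  rw [← sub_eq_zero, ← integral_sub (h1 v) (h2 v)]
  have hfv := hk_Xd_contDiff b v hf
  have hpv := hk_Xd_contDiff b v hφ
  rw [← hk_integral_Xd b v (h := fun g => f g * Xd b v φ g - Xd b v f g * φ g)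
    ((hf.mul hpv).sub (hfv.mul hφ))
    ((hk_Xd_compact b v hs).mul_left.sub hs.mul_left)]
  congr 1; ext g
  rw [hk_Xd_sub b v (dd (hf.mul hpv) g) (dd (hfv.mul hφ) g),
    hk_Xd_mul b v (dd hf g) (dd hpv g), hk_Xd_mul b v (dd hfv g) (dd hφ g)]
  ring

end meas

theorem hk_vv (b : V₁ →ₗ[ℝ] V₁ →ₗ[ℝ] V₂) (hskew : ∀ z z' : V₁, b z z' = - b z' z) (v : V₁) :
    b v v = 0 := by
  have h : (2 : ℝ) • b v v = 0 := by
    rw [two_smul]; nth_rewrite 1 [hskew v v]; simp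
  simpa using h

/-- regularized gauge -/
noncomputable def hkA (s : ℝ) (g : V₁ × V₂) : ℝ := (‖g.1‖ ^ 2 + s) ^ 2 + 16 * ‖g.2‖ ^ 2

theorem hkA_contDiff (s : ℝ) : ContDiff ℝ (⊤ : ℕ∞) (hkA s : V₁ × V₂ → ℝ) := by
  unfold hkA
  exact (((contDiff_fst.norm_sq ℝ).add contDiff_const).pow 2).add
    (contDiff_const.mul (contDiff_snd.norm_sq ℝ))

theorem hkA_pos {s : ℝ} (hs : 0 < s) (g : V₁ × V₂) : 0 < hkA s g := by
  unfold hkA; positivity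

theorem hk_Xd_A (b : V₁ →ₗ[ℝ] V₁ →ₗ[ℝ] V₂) (s : ℝ) (v : V₁) (g : V₁ × V₂) :
    Xd b v (hkA s) g = 4 * (‖g.1‖ ^ 2 + s) * ⟪g.1, v⟫ + 16 * ⟪b g.1 v, g.2⟫ := by
  have h1 : HasFDerivAt (fun g : V₁ × V₂ => g.1) (ContinuousLinearMap.fst ℝ V₁ V₂) g :=
    hasFDerivAt_fst
  have h2 : HasFDerivAt (fun g : V₁ × V₂ => g.2) (ContinuousLinearMap.snd ℝ V₁ V₂) g :=
    hasFDerivAt_snd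
  have := ((h1.norm_sq.add_const s).pow 2).add (h2.norm_sq.const_mul 16)
  have e : (hkA s : V₁ × V₂ → ℝ) = _ := rfl
  rw [Xd, HasFDerivAt.fderiv (f := hkA s) this]
  simp [real_inner_comm, inner_smul_right]
  rw [real_inner_comm]
  ring

theorem hk_Xd_Xd_A (b : V₁ →ₗ[ℝ] V₁ →ₗ[ℝ] V₂) (hskew : ∀ z z' : V₁, b z z' = - b z' z)
    (s : ℝ) (v : V₁) (g : V₁ × V₂) :
    Xd b v (Xd b v (hkA s)) g = 8 * ⟪g.1, v⟫ ^ 2 + 4 * (‖g.1‖ ^ 2 + s) * ‖v‖ ^ 2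
      + 8 * ‖b g.1 v‖ ^ 2 := by
  have h1 : HasFDerivAt (fun g : V₁ × V₂ => g.1) (ContinuousLinearMap.fst ℝ V₁ V₂) g :=
    hasFDerivAt_fst
  have h2 : HasFDerivAt (fun g : V₁ × V₂ => g.2) (ContinuousLinearMap.snd ℝ V₁ V₂) g :=
    hasFDerivAt_snd
  have h3 : HasFDerivAt (fun g : V₁ × V₂ => b g.1 v)
      ((LinearMap.toContinuousLinearMap (b.flip v)).comp (ContinuousLinearMap.fst ℝ V₁ V₂)) g :=
    (LinearMap.toContinuousLinearMap (b.flip v)).hasFDerivAt.comp g h1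
  have := (((h1.norm_sq.add_const s).const_mul 4).mul (h1.inner ℝ (hasFDerivAt_const v g))).add
    ((h3.inner ℝ h2).const_mul 16)
  have e : Xd b v (hkA s) = fun g => 4 * (‖g.1‖ ^ 2 + s) * ⟪g.1, v⟫ + 16 * ⟪b g.1 v, g.2⟫ := by
    ext g; exact hk_Xd_A b s v g
  have hvv : b v v = 0 := hk_vv b hskew v
  rw [e, Xd, HasFDerivAt.fderiv (f := fun g : V₁ × V₂ =>
    4 * (‖g.1‖ ^ 2 + s) * ⟪g.1, v⟫ + 16 * ⟪b g.1 v, g.2⟫) this]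
  simp [real_inner_comm, inner_smul_right, hvv, fderivInnerCLM_apply]
  ring

theorem hk_hLap_A (m k : ℕ) (hdV₁ : Module.finrank ℝ V₁ = m) (hdV₂ : Module.finrank ℝ V₂ = k)
    (b : V₁ →ₗ[ℝ] V₁ →ₗ[ℝ] V₂) (hskew : ∀ z z' : V₁, b z z' = - b z' z)
    (J : V₂ → V₁ →ₗ[ℝ] V₁) (hJ : ∀ (t : V₂) (z z' : V₁), ⟪J t z, z'⟫ = ⟪b z z', t⟫)
    (hH : ∀ (t : V₂) (z : V₁), ‖J t z‖ = ‖t‖ * ‖z‖) {s : ℝ} (hs : 0 < s) (g : V₁ × V₂) :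
    hLap b (fun g => hkA s g ^ ((2 - ((m : ℝ) + 2 * k)) / 4)) g =
      (2 - ((m : ℝ) + 2 * k)) * m * s * hkA s g ^ ((2 - ((m : ℝ) + 2 * k)) / 4 - 1) := by
  set p : ℝ := (2 - ((m : ℝ) + 2 * k)) / 4 with hp
  have dd : ∀ {u : V₁ × V₂ → ℝ}, ContDiff ℝ (⊤ : ℕ∞) u → ∀ g, DifferentiableAt ℝ u g :=
    fun hu g => (hu.differentiable (by simp)).differentiableAt
  have hA := hkA_contDiff (V₁ := V₁) (V₂ := V₂) s
  have hA0 : ∀ g : V₁ × V₂, hkA s g ≠ 0 := fun g => (hkA_pos hs g).ne'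
  have e1 : ∀ v, Xd b v (fun g => hkA s g ^ p) =
      fun g => (p * hkA s g ^ (p - 1)) * Xd b v (hkA s) g := fun v => by
    ext g; exact hk_Xd_rpow b v (dd hA g) p (hA0 g)
  have hc : ContDiff ℝ (⊤ : ℕ∞) (fun g : V₁ × V₂ => hkA s g ^ (p - 1)) :=
    hA.rpow_const_of_ne hA0
  have e2 : ∀ v, Xd b v (Xd b v (fun g => hkA s g ^ p)) g =
      p * hkA s g ^ (p - 1) * Xd b v (Xd b v (hkA s)) g +
      p * (p - 1) * hkA s g ^ (p - 1 - 1) * (Xd b v (hkA s) g) ^ 2 := fun v => by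
    rw [e1, hk_Xd_mul b v (dd (contDiff_const.mul hc) g) (dd (hk_Xd_contDiff b v hA) g),
      hk_Xd_mul b v (by fun_prop) (dd hc g), hk_Xd_rpow b v (dd hA g) (p - 1) (hA0 g)]
    simp [Xd]; ring
  simp only [hLap, e2, Finset.sum_add_distrib, ← Finset.mul_sum]
  set e := stdOrthonormalBasis ℝ V₁ with he
  let T := stdOrthonormalBasis ℝ V₂
  have hzz : ∑ i, ⟪g.1, e i⟫ ^ 2 = ‖g.1‖ ^ 2 := e.sum_sq_inner_left g.1
  have hone : ∑ i, ‖e i‖ ^ 2 = m := by simp [hdV₁]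
  have hbb : ∑ i, ‖b g.1 (e i)‖ ^ 2 = k * ‖g.1‖ ^ 2 := by
    have : ∀ i, ‖b g.1 (e i)‖ ^ 2 = ∑ j, ⟪J (T j) g.1, e i⟫ ^ 2 := fun i => by
      rw [← T.sum_sq_inner_left]
      simp [hJ]
    simp_rw [this]
    rw [Finset.sum_comm]
    simp_rw [e.sum_sq_inner_left, hH]
    simp [hdV₂]
  have s1 : ∑ i, Xd b (e i) (Xd b (e i) (hkA s)) g =
      4 * ((m + 2 * k + 2) * ‖g.1‖ ^ 2 + m * s) := by
    simp only [hk_Xd_Xd_A b hskew, Finset.sum_add_distrib, ← Finset.mul_sum, hzz, hone, hbb]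
    ring
  have s2 : ∑ i, (Xd b (e i) (hkA s) g) ^ 2 = 16 * ‖g.1‖ ^ 2 * hkA s g := by
    have : ∀ i, Xd b (e i) (hkA s) g =
        ⟪(4 * (‖g.1‖ ^ 2 + s)) • g.1 + (16 : ℝ) • J g.2 g.1, e i⟫ := fun i => by
      rw [hk_Xd_A, inner_add_left, inner_smul_left, inner_smul_left, hJ]; simp
    simp_rw [this]
    have orth : ⟪g.1, J g.2 g.1⟫ = 0 := by
      rw [real_inner_comm, hJ, hk_vv b hskew g.1]; simp
    rw [e.sum_sq_inner_left, norm_add_sq_real, inner_smul_left, inner_smul_right, orth,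
      norm_smul, norm_smul, hH, hkA, mul_pow, mul_pow]
    simp only [Real.norm_eq_abs, sq_abs]
    ring
  rw [s1, s2]
  have : hkA s g ^ (p - 1) = hkA s g ^ (p - 1 - 1) * hkA s g := by
    rw [← Real.rpow_add_one (hA0 g)]; ring_nf
  rw [this, hp]
  ring

section meas2
open Filter Topology
variable [MeasurableSpace V₁] [BorelSpace V₁] [MeasurableSpace V₂] [BorelSpace V₂]

theorem hk_ballint (d : ℕ) (hd : Module.finrank ℝ V₁ = d) (hd1 : 1 ≤ d) (r : ℝ) (hr : r < d)
    (R : ℝ) : IntegrableOn (fun x : V₁ => ‖x‖ ^ (-r)) (Metric.ball 0 R) := by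
  have : Nontrivial V₁ := Module.nontrivial_of_finrank_pos (R := ℝ) (by omega)
  rw [integrableOn_fun_norm_addHaar (μ := volume) (f := fun y : ℝ => y ^ (-r)), hd]
  rcases le_or_gt R 0 with h | h
  · simp [Set.Ioo_eq_empty (not_lt.mpr h)]
  have h1 : IntegrableOn (fun y : ℝ => y ^ ((d : ℝ) - 1 - r)) (Set.Ioo 0 R) := by
    rw [intervalIntegral.integrableOn_Ioo_rpow_iff h]; linarith
  refine h1.congr_fun (fun y hy => ?_) measurableSet_Ioo
  simp only [smul_eq_mul]
  rw [← Real.rpow_natCast, ← Real.rpow_add hy.1]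
  congr 1
  push_cast [Nat.cast_sub hd1]; ring

theorem hk_scale (m k : ℕ) (hdV₁ : Module.finrank ℝ V₁ = m) (hdV₂ : Module.finrank ℝ V₂ = k)
    {ε : ℝ} (hε : 0 < ε) (F : V₁ × V₂ → ℝ) :
    ∫ g, F g = (ε ^ m * (ε ^ 2) ^ k) * ∫ g : V₁ × V₂, F (ε • g.1, ε ^ 2 • g.2) := by
  have := hk_haar (V₁ := V₁) (V₂ := V₂)
  let L : (V₁ × V₂) →ₗ[ℝ] (V₁ × V₂) :=
    (ε • (LinearMap.id : V₁ →ₗ[ℝ] V₁)).prodMap ((ε ^ 2) • (LinearMap.id : V₂ →ₗ[ℝ] V₂))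
  have hdet : LinearMap.det L = ε ^ m * (ε ^ 2) ^ k := by
    simp [L, LinearMap.det_prodMap, LinearMap.det_smul, hdV₁, hdV₂]
  have hpos : 0 < ε ^ m * (ε ^ 2) ^ k := by positivity
  have hmap := Measure.map_linearMap_addHaar_eq_smul_addHaar (volume : Measure (V₁ × V₂))
    (f := L) (by rw [hdet]; exact hpos.ne')
  have hL : ∀ g, L g = (ε • g.1, ε ^ 2 • g.2) := fun g => rfl
  let Le : (V₁ × V₂) ≃L[ℝ] (V₁ × V₂) :=
    (L.equivOfDetNeZero (by rw [hdet]; exact hpos.ne')).toContinuousLinearEquiv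
  have hemb : MeasurableEmbedding L := Le.toHomeomorph.measurableEmbedding
  have h1 : ∫ g : V₁ × V₂, F (ε • g.1, ε ^ 2 • g.2) = ∫ g, F g ∂(Measure.map L volume) := by
    rw [hemb.integral_map]; rfl
  rw [h1, hmap, integral_smul_measure, hdet, abs_of_pos (inv_pos.mpr hpos),
    ENNReal.toReal_ofReal (inv_pos.mpr hpos).le, smul_eq_mul, mul_inv_cancel_left₀ hpos.ne']

theorem hk_Aint (m k : ℕ) (hdV₁ : Module.finrank ℝ V₁ = m) (hdV₂ : Module.finrank ℝ V₂ = k) :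
    Integrable (fun g : V₁ × V₂ => hkA 1 g ^ ((2 - ((m : ℝ) + 2 * k)) / 4 - 1)) := by
  have i1 : Integrable (fun z : V₁ => ((1 : ℝ) + ‖z‖ ^ 2) ^ (-((m : ℝ) + 1) / 2)) :=
    integrable_rpow_neg_one_add_norm_sq (by rw [hdV₁]; linarith)
  have i2 : Integrable (fun z : V₂ => ((1 : ℝ) + ‖z‖ ^ 2) ^ (-((k : ℝ) + 1 / 2) / 2)) :=
    integrable_rpow_neg_one_add_norm_sq (by rw [hdV₂]; linarith)
  have i3 := i1.mul_prod i2
  refine Integrable.mono' i3 ?_ (Eventually.of_forall fun g => ?_)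
  · exact ((hkA_contDiff 1).rpow_const_of_ne
      (fun g => (hkA_pos one_pos g).ne')).continuous.aestronglyMeasurable
  have hA := hkA_pos one_pos g
  rw [Real.norm_of_nonneg (by positivity)]
  have e : (2 - ((m : ℝ) + 2 * k)) / 4 - 1 =
      -((m : ℝ) + 1) / 4 + -((k : ℝ) + 1 / 2) / 2 := by ring
  rw [e, Real.rpow_add hA]
  refine mul_le_mul ?_ ?_ (by positivity) (by positivity)
  · have : ((1 : ℝ) + ‖g.1‖ ^ 2) ^ (-((m : ℝ) + 1) / 2) =
        (((1 : ℝ) + ‖g.1‖ ^ 2) ^ 2) ^ (-((m : ℝ) + 1) / 4) := by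
      rw [← Real.rpow_natCast (1 + ‖g.1‖ ^ 2), ← Real.rpow_mul (by positivity)]
      congr 1; push_cast; ring
    rw [this]
    refine Real.rpow_le_rpow_of_nonpos (by positivity) ?_ ?_
    · unfold hkA; nlinarith [sq_nonneg ‖g.2‖]
    · have : (0 : ℝ) ≤ m := m.cast_nonneg
      linarith
  · refine Real.rpow_le_rpow_of_nonpos (by positivity) ?_ ?_
    · unfold hkA; nlinarith [sq_nonneg ‖g.2‖, sq_nonneg ‖g.1‖]
    · have : (0 : ℝ) ≤ k := k.cast_nonneg
      linarith

theorem hk_bound (m k : ℕ) (hm : 1 ≤ m) (hk : 1 ≤ k) {s : ℝ} (hs : 0 ≤ s) (g : V₁ × V₂)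
    (h1 : g.1 ≠ 0) (h2 : g.2 ≠ 0) :
    hkA s g ^ ((2 - ((m : ℝ) + 2 * k)) / 4) ≤
      ‖g.1‖ ^ (-((m : ℝ) - 1)) * ‖g.2‖ ^ (-((k : ℝ) - 1 / 2)) := by
  have n1 : 0 < ‖g.1‖ := norm_pos_iff.mpr h1
  have n2 : 0 < ‖g.2‖ := norm_pos_iff.mpr h2
  have hA : 0 < hkA s g := by unfold hkA; positivity
  have hm' : (1 : ℝ) ≤ m := by exact_mod_cast hm
  have hk' : (1 : ℝ) ≤ k := by exact_mod_cast hk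
  have e : (2 - ((m : ℝ) + 2 * k)) / 4 =
      -((m : ℝ) - 1) / 4 + -((k : ℝ) - 1 / 2) / 2 := by ring
  rw [e, Real.rpow_add hA]
  refine mul_le_mul ?_ ?_ (by positivity) (by positivity)
  · have : ‖g.1‖ ^ (-((m : ℝ) - 1)) = (‖g.1‖ ^ 4) ^ (-((m : ℝ) - 1) / 4) := by
      rw [← Real.rpow_natCast, ← Real.rpow_mul (by positivity)]
      congr 1; push_cast; ring
    rw [this]
    refine Real.rpow_le_rpow_of_nonpos (by positivity) ?_ (by linarith)
    unfold hkA
    nlinarith [sq_nonneg ‖g.2‖, mul_nonneg (sq_nonneg ‖g.1‖) hs]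
  · have : ‖g.2‖ ^ (-((k : ℝ) - 1 / 2)) = (‖g.2‖ ^ 2) ^ (-((k : ℝ) - 1 / 2) / 2) := by
      rw [← Real.rpow_natCast, ← Real.rpow_mul (by positivity)]
      congr 1; push_cast; ring
    rw [this]
    refine Real.rpow_le_rpow_of_nonpos (by positivity) ?_ (by linarith)
    unfold hkA
    nlinarith [sq_nonneg ‖g.2‖, sq_nonneg (‖g.1‖ ^ 2 + s)]

theorem hk_lim_left (m k : ℕ) (hm : 1 ≤ m) (hk : 1 ≤ k)
    (hdV₁ : Module.finrank ℝ V₁ = m) (hdV₂ : Module.finrank ℝ V₂ = k)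
    {u : V₁ × V₂ → ℝ} (hu : Continuous u) (hc : HasCompactSupport u) :
    Tendsto (fun ε : ℝ => ∫ g, hkA (ε ^ 2) g ^ ((2 - ((m : ℝ) + 2 * k)) / 4) * u g) (𝓝[>] 0)
      (𝓝 (∫ g, hkA 0 g ^ ((2 - ((m : ℝ) + 2 * k)) / 4) * u g)) := by
  have : Nontrivial V₁ := Module.nontrivial_of_finrank_pos (R := ℝ) (by omega)
  have : Nontrivial V₂ := Module.nontrivial_of_finrank_pos (R := ℝ) (by omega)
  obtain ⟨M, hM⟩ := hu.bounded_above_of_compact_support hc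
  obtain ⟨R, hR⟩ := hc.isCompact.isBounded.subset_ball (0 : V₁ × V₂)
  have i1 := hk_ballint m hdV₁ hm ((m : ℝ) - 1) (by linarith) R
  have i2 := hk_ballint k hdV₂ hk ((k : ℝ) - 1 / 2) (by linarith) R
  rw [← integrable_indicator_iff Metric.isOpen_ball.measurableSet] at i1 i2
  have i3 := (i1.mul_prod i2).mul_const M
  have ae1 : ∀ᵐ g : V₁ × V₂, g.1 ≠ 0 :=
    Measure.quasiMeasurePreserving_fst.ae (Measure.ae_ne volume (0 : V₁))
  have ae2 : ∀ᵐ g : V₁ × V₂, g.2 ≠ 0 :=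
    Measure.quasiMeasurePreserving_snd.ae (Measure.ae_ne volume (0 : V₂))
  refine tendsto_integral_filter_of_dominated_convergence _ ?_ ?_ i3 ?_
  · filter_upwards [self_mem_nhdsWithin] with ε hε
    have hε' : (0 : ℝ) < ε ^ 2 := pow_pos hε 2
    exact (((hkA_contDiff _).rpow_const_of_ne
      (fun g => (hkA_pos hε' g).ne')).continuous.mul hu).aestronglyMeasurable
  · filter_upwards with ε
    filter_upwards [ae1, ae2] with g h1 h2
    have hA : 0 ≤ hkA (ε ^ 2) g := by unfold hkA; positivity
    by_cases hg : g ∈ Metric.ball (0 : V₁ × V₂) R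
    · have hg' : ‖g.1‖ < R ∧ ‖g.2‖ < R := by
        rw [mem_ball_zero_iff, Prod.norm_def] at hg
        exact max_lt_iff.mp hg
      rw [Set.indicator_of_mem (by simpa using hg'.1), Set.indicator_of_mem (by simpa using hg'.2),
        norm_mul, Real.norm_of_nonneg (by positivity)]
      exact mul_le_mul (hk_bound m k hm hk (sq_nonneg ε) g h1 h2) (hM g) (norm_nonneg _)
        (by positivity)
    · have : u g = 0 := image_eq_zero_of_notMem_tsupport fun h => hg (hR h)
      rw [this]
      simp only [mul_zero, norm_zero]
      have hM0 : 0 ≤ M := (norm_nonneg _).trans (hM 0)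
      refine mul_nonneg (mul_nonneg ?_ ?_) hM0 <;>
      exact Set.indicator_nonneg (fun x _ => by positivity) _
  · filter_upwards [ae1] with g h1
    have n1 : 0 < ‖g.1‖ := norm_pos_iff.mpr h1
    refine Tendsto.mul_const _ (Tendsto.rpow_const ?_ (Or.inl ?_))
    · have : Continuous (fun ε : ℝ => hkA (ε ^ 2) g) := by unfold hkA; fun_prop
      have := this.tendsto 0
      simp only [ne_eq, OfNat.ofNat_ne_zero, not_false_eq_true, zero_pow] at this
      exact this.mono_left nhdsWithin_le_nhds
    · unfold hkA; positivity

theorem hk_lim_right (m k : ℕ)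
    (hdV₁ : Module.finrank ℝ V₁ = m) (hdV₂ : Module.finrank ℝ V₂ = k)
    {u : V₁ × V₂ → ℝ} (hu : Continuous u) (hc : HasCompactSupport u) :
    Tendsto (fun ε : ℝ => ε ^ 2 * ∫ g, hkA (ε ^ 2) g ^ ((2 - ((m : ℝ) + 2 * k)) / 4 - 1) * u g)
      (𝓝[>] 0)
      (𝓝 ((∫ g : V₁ × V₂, hkA 1 g ^ ((2 - ((m : ℝ) + 2 * k)) / 4 - 1)) * u (0, 0))) := by
  obtain ⟨M, hM⟩ := hu.bounded_above_of_compact_support hc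
  have hI := hk_Aint (V₁ := V₁) (V₂ := V₂) m k hdV₁ hdV₂
  set q : ℝ := (2 - ((m : ℝ) + 2 * k)) / 4 - 1 with hq
  have key : ∀ ε : ℝ, 0 < ε → ε ^ 2 * ∫ g, hkA (ε ^ 2) g ^ q * u g =
      ∫ g : V₁ × V₂, hkA 1 g ^ q * u (ε • g.1, ε ^ 2 • g.2) := by
    intro ε hε
    rw [hk_scale m k hdV₁ hdV₂ hε, ← integral_const_mul, ← integral_const_mul]
    congr 1; ext g
    have e1 : hkA (ε ^ 2) ((ε • g.1, ε ^ 2 • g.2) : V₁ × V₂) = ε ^ 4 * hkA 1 g := by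
      simp only [hkA, norm_smul, Real.norm_eq_abs, mul_pow, sq_abs]; ring
    have e2 : ε ^ 2 * (ε ^ m * (ε ^ 2) ^ k) * (ε ^ 4) ^ q = 1 := by
      rw [← pow_mul, ← pow_add, ← pow_add, ← Real.rpow_natCast, ← Real.rpow_natCast,
        ← Real.rpow_mul hε.le, ← Real.rpow_add hε, ← Real.rpow_zero ε]
      congr 1
      push_cast; rw [hq]; ring
    rw [e1, Real.mul_rpow (by positivity) (hkA_pos one_pos g).le]
    linear_combination (hkA 1 g ^ q * u (ε • g.1, ε ^ 2 • g.2)) * e2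
  have hcont : Continuous (fun g : V₁ × V₂ => hkA 1 g ^ q) :=
    ((hkA_contDiff 1).rpow_const_of_ne (fun g => (hkA_pos one_pos g).ne')).continuous
  rw [← integral_mul_const]
  have hlim : Tendsto (fun ε : ℝ => ∫ g : V₁ × V₂, hkA 1 g ^ q * u (ε • g.1, ε ^ 2 • g.2))
      (𝓝[>] 0) (𝓝 (∫ g : V₁ × V₂, hkA 1 g ^ q * u (0, 0))) := by
    refine tendsto_integral_filter_of_dominated_convergence _ ?_ ?_ (hI.mul_const M) ?_
    · filter_upwards with ε
      exact (hcont.mul (hu.comp (by fun_prop))).aestronglyMeasurable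
    · filter_upwards with ε
      filter_upwards with g
      have := (hkA_pos one_pos g).le
      rw [norm_mul, Real.norm_of_nonneg (by positivity)]
      exact mul_le_mul_of_nonneg_left (hM _) (by positivity)
    · filter_upwards with g
      refine Tendsto.const_mul _ ?_
      have : Continuous (fun ε : ℝ => u (ε • g.1, ε ^ 2 • g.2)) := hu.comp (by fun_prop)
      have := this.tendsto 0
      simp only [ne_eq, OfNat.ofNat_ne_zero, not_false_eq_true, zero_pow, zero_smul] at this
      exact this.mono_left nhdsWithin_le_nhds
  refine hlim.congr' ?_
  filter_upwards [self_mem_nhdsWithin] with ε hε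
  exact (key ε hε).symm

theorem hk_Apos (m k : ℕ) (hdV₁ : Module.finrank ℝ V₁ = m) (hdV₂ : Module.finrank ℝ V₂ = k) :
    0 < ∫ g : V₁ × V₂, hkA 1 g ^ ((2 - ((m : ℝ) + 2 * k)) / 4 - 1) := by
  have := hk_haar (V₁ := V₁) (V₂ := V₂)
  have hp : ∀ g : V₁ × V₂, 0 < hkA 1 g ^ ((2 - ((m : ℝ) + 2 * k)) / 4 - 1) := fun g =>
    Real.rpow_pos_of_pos (hkA_pos one_pos g) _
  rw [integral_pos_iff_support_of_nonneg (fun g => (hp g).le) (hk_Aint m k hdV₁ hdV₂)]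
  have : Function.support (fun g : V₁ × V₂ => hkA 1 g ^ ((2 - ((m : ℝ) + 2 * k)) / 4 - 1)) =
      Set.univ := by
    ext g; simp [(hp g).ne']
  rw [this]
  exact Measure.measure_univ_pos.mpr (NeZero.ne _)

theorem hk_Ng (q : ℝ) (g : V₁ × V₂) : Ng g ^ q = hkA 0 g ^ (q / 4) := by
  have : aF g = hkA 0 g := by simp [aF, psiF, chiF, hkA]
  rw [Ng, this, ← Real.rpow_mul (by unfold hkA; positivity)]
  congr 1; ring

end meas2
end helpers

theorem riesz_htype_folland_kaplan_fundamental_solution {V₁ V₂ : Type*} [NormedAddCommGroup V₁] [InnerProductSpace ℝ V₁]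
    [FiniteDimensional ℝ V₁] [NormedAddCommGroup V₂] [InnerProductSpace ℝ V₂]
    [FiniteDimensional ℝ V₂] (m k : ℕ) (hm : 1 ≤ m) (hk : 1 ≤ k)
    (hdV₁ : Module.finrank ℝ V₁ = m) (hdV₂ : Module.finrank ℝ V₂ = k)
    (b : V₁ →ₗ[ℝ] V₁ →ₗ[ℝ] V₂) (hskew : ∀ z z' : V₁, b z z' = - b z' z)
    (J : V₂ → V₁ →ₗ[ℝ] V₁) (hJ : ∀ (t : V₂) (z z' : V₁), ⟪J t z, z'⟫ = ⟪b z z', t⟫) (hH : ∀ (t : V₂) (z : V₁), ‖J t z‖ = ‖t‖ * ‖z‖) [MeasurableSpace V₁] [BorelSpace V₁] [MeasurableSpace V₂] [BorelSpace V₂] :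
    ∃ c : ℝ, 0 < c ∧ ∀ φ : V₁ × V₂ → ℝ, ContDiff ℝ (⊤ : ℕ∞) φ → HasCompactSupport φ →
      (∫ g : V₁ × V₂, (-c * Ng g ^ ((2 : ℝ) - ((m : ℝ) + 2 * k))) * hLap b φ g) = φ (0, 0) := by

  have hC := hk_Apos (V₁ := V₁) (V₂ := V₂) m k hdV₁ hdV₂
  set C := ∫ g : V₁ × V₂, hkA 1 g ^ ((2 - ((m : ℝ) + 2 * k)) / 4 - 1) with hCdef
  have hm' : (1 : ℝ) ≤ m := by exact_mod_cast hm
  have hk' : (1 : ℝ) ≤ k := by exact_mod_cast hk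
  have hD : 0 < ((m : ℝ) + 2 * k - 2) * m * C := by
    have : 0 < (m : ℝ) + 2 * k - 2 := by linarith
    positivity
  refine ⟨(((m : ℝ) + 2 * k - 2) * m * C)⁻¹, inv_pos.mpr hD, fun φ hφ hs => ?_⟩
  have hLc : Continuous (hLap b φ) := by
    unfold hLap
    exact continuous_finsetSum _ fun i _ =>
      (hk_Xd_contDiff b _ (hk_Xd_contDiff b _ hφ)).continuous
  have hLs : HasCompactSupport (hLap b φ) := by
    refine HasCompactSupport.of_support_subset_isCompact hs.isCompact fun x hx => ?_
    by_contra hn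
    refine hx (Finset.sum_eq_zero fun i _ => ?_)
    refine image_eq_zero_of_notMem_tsupport fun h => hn ?_
    have hsub : ∀ (v : V₁) (f : V₁ × V₂ → ℝ), tsupport (Xd b v f) ⊆ tsupport f := by
      intro v f
      refine (closure_mono ?_).trans (tsupport_fderiv_subset ℝ (f := f))
      intro y hy hy'
      exact hy (by simp [Xd, hy'])
    exact hsub _ _ (hsub _ _ h)
  have l1 := hk_lim_left m k hm hk hdV₁ hdV₂ hLc hLs
  have l2 := (hk_lim_right m k hdV₁ hdV₂ hφ.continuous hs).const_mul
    ((2 - ((m : ℝ) + 2 * k)) * m)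
  have heq := tendsto_nhds_unique (l1.congr' ?_) l2
  · simp_rw [hk_Ng, mul_assoc]
    rw [integral_const_mul, heq, ← hCdef]
    have hI := inv_mul_cancel₀ hD.ne'
    linear_combination φ (0, 0) * hI
  · filter_upwards [self_mem_nhdsWithin] with ε hε
    have hε' : (0 : ℝ) < ε ^ 2 := pow_pos hε 2
    rw [hk_symm b ((hkA_contDiff _).rpow_const_of_ne (fun g => (hkA_pos hε' g).ne')) hφ hs,
      ← integral_const_mul, ← integral_const_mul]
    congr 1; ext g
    rw [hk_hLap_A m k hdV₁ hdV₂ b hskew J hJ hH hε']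
    ring
end

section
/- Assume the data is of Heisenberg type. Set ω_Q = ∫_{{g ∈ G : N(g) < 1}} |XN(g)|^Q dg and σ_Q = Q ω_Q, and define Γ_Q(g) = −σ_Q^{−1/(Q−1)} log N(g) for g ≠ e. Then Γ_Q is a fundamental solution of the horizontal Q-Laplacian with pole at e: for every smooth compactly supported φ : G → ℝ, ∫_G |XΓ_Q(g)|^{Q−2} ⟨XΓ_Q(g), Xφ(g)⟩ dg = φ(e). -/
open scoped RealInnerProductSpace
open MeasureTheory

section aux
set_option linter.unusedSectionVars false

variable {V₁ V₂ : Type*} [NormedAddCommGroup V₁] [InnerProductSpace ℝ V₁]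
  [NormedAddCommGroup V₂] [InnerProductSpace ℝ V₂]

def dil (r : ℝ) (g : V₁ × V₂) : V₁ × V₂ := (r • g.1, r ^ 2 • g.2)

lemma aF_nonneg (g : V₁ × V₂) : 0 ≤ aF g := by unfold aF psiF chiF; positivity

lemma aF_pos {g : V₁ × V₂} (hg : g ≠ (0, 0)) : 0 < aF g := by
  rcases eq_or_ne g.1 0 with h1 | h1
  · have h2 : g.2 ≠ 0 := fun h2 => hg (Prod.ext h1 h2)
    have := norm_pos_iff.mpr h2
    unfold aF psiF chiF; positivity
  · have := norm_pos_iff.mpr h1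
    unfold aF psiF chiF; positivity

lemma Ng_nonneg (g : V₁ × V₂) : 0 ≤ Ng g := Real.rpow_nonneg (aF_nonneg g) _

lemma Ng_pos {g : V₁ × V₂} (hg : g ≠ (0, 0)) : 0 < Ng g := Real.rpow_pos_of_pos (aF_pos hg) _

lemma Ng_pow (g : V₁ × V₂) : Ng g ^ 4 = aF g := by
  unfold Ng
  rw [← Real.rpow_natCast, ← Real.rpow_mul (aF_nonneg g)]
  norm_num

lemma Ng_zero : Ng ((0, 0) : V₁ × V₂) = 0 := by
  have := Ng_pow ((0, 0) : V₁ × V₂)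
  simp [aF, psiF, chiF] at this
  exact this

lemma aF_cont : Continuous (aF : V₁ × V₂ → ℝ) := by
  unfold aF psiF chiF; fun_prop

lemma Ng_cont : Continuous (Ng : V₁ × V₂ → ℝ) := by
  unfold Ng
  exact aF_cont.rpow_const (fun _ => Or.inr (by norm_num))

lemma norm_fst_le_Ng (g : V₁ × V₂) : ‖g.1‖ ≤ Ng g := by
  apply le_of_pow_le_pow_left₀ (n := 4) (by norm_num) (Ng_nonneg g)
  rw [Ng_pow]; unfold aF psiF chiF
  nlinarith [sq_nonneg ‖g.2‖]

lemma norm_snd_le_Ng (g : V₁ × V₂) : 4 * ‖g.2‖ ≤ Ng g ^ 2 := by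
  apply le_of_pow_le_pow_left₀ (n := 2) (by norm_num) (by positivity)
  have := Ng_pow g
  calc (4 * ‖g.2‖) ^ 2 ≤ aF g := by
        unfold aF psiF chiF; nlinarith [sq_nonneg (‖g.1‖ ^ 2)]
    _ = _ := by rw [← this]; ring

lemma Ng_dil {r : ℝ} (g : V₁ × V₂) : Ng (dil r g) = |r| * Ng g := by
  apply (pow_left_inj₀ (Ng_nonneg _) (mul_nonneg (abs_nonneg r) (Ng_nonneg _)) (n := 4) (by norm_num)).mp
  rw [mul_pow, Ng_pow, Ng_pow]
  simp only [aF, psiF, chiF, dil, norm_smul, norm_pow, Real.norm_eq_abs]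
  ring

lemma dil_dil (r s : ℝ) (g : V₁ × V₂) : dil r (dil s g) = dil (r * s) g := by
  simp [dil, smul_smul, mul_pow]

lemma dil_one (g : V₁ × V₂) : dil 1 g = g := by simp [dil]

lemma dil_cont : Continuous (fun p : (V₁ × V₂) × ℝ => dil p.2 p.1) := by
  unfold dil; fun_prop

variable [FiniteDimensional ℝ V₁] [FiniteDimensional ℝ V₂]
variable [MeasurableSpace V₁] [BorelSpace V₁] [MeasurableSpace V₂] [BorelSpace V₂]

lemma map_dil {r : ℝ} (hr : 0 < r) :
    Measure.map (dil r) (volume : Measure (V₁ × V₂)) =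
      ENNReal.ofReal ((r ^ (Module.finrank ℝ V₁ + 2 * Module.finrank ℝ V₂))⁻¹) • volume := by
  have h : (dil r : V₁ × V₂ → V₁ × V₂) = Prod.map (fun z => r • z) (fun t => r ^ 2 • t) := rfl
  rw [h, Measure.volume_eq_prod, ← Measure.map_prod_map _ _ (by fun_prop) (by fun_prop),
    Measure.map_addHaar_smul _ hr.ne', Measure.map_addHaar_smul _ (by positivity),
    Measure.prod_smul_left, Measure.prod_smul_right, smul_smul, ← ENNReal.ofReal_mul (by positivity)]
  congr 2
  rw [abs_of_pos (by positivity), abs_of_pos (by positivity), ← mul_inv, pow_add, pow_mul]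

lemma integral_dil {r : ℝ} (hr : 0 < r) (f : V₁ × V₂ → ℝ) :
    ∫ g, f (dil r g) = (r ^ (Module.finrank ℝ V₁ + 2 * Module.finrank ℝ V₂))⁻¹ * ∫ g, f g := by
  let e : (V₁ × V₂) ≃ₜ (V₁ × V₂) :=
    { toFun := dil r
      invFun := dil r⁻¹
      left_inv := fun g => by rw [dil_dil, inv_mul_cancel₀ hr.ne', dil_one]
      right_inv := fun g => by rw [dil_dil, mul_inv_cancel₀ hr.ne', dil_one]
      continuous_toFun := by unfold dil; fun_prop
      continuous_invFun := by unfold dil; fun_prop }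
  have := e.measurableEmbedding.integral_map (μ := volume) f
  change ∫ y, f y ∂(Measure.map (dil r) volume) = ∫ x, f (dil r x) at this
  rw [← this, map_dil hr, integral_smul_measure, ENNReal.toReal_ofReal (by positivity), smul_eq_mul]

lemma integrable_dil {r : ℝ} (hr : 0 < r) {f : V₁ × V₂ → ℝ}
    (hf : Integrable (fun g => f (dil r g))) : Integrable f := by
  let e : (V₁ × V₂) ≃ₜ (V₁ × V₂) :=
    { toFun := dil r
      invFun := dil r⁻¹
      left_inv := fun g => by rw [dil_dil, inv_mul_cancel₀ hr.ne', dil_one]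
      right_inv := fun g => by rw [dil_dil, mul_inv_cancel₀ hr.ne', dil_one]
      continuous_toFun := by unfold dil; fun_prop
      continuous_invFun := by unfold dil; fun_prop }
  have := (e.measurableEmbedding.integrable_map_iff (μ := volume) (g := f)).mpr hf
  change Integrable f (Measure.map (dil r) volume) at this
  rw [map_dil hr] at this
  rwa [integrable_smul_measure (by simp; positivity) (by simp)] at this

lemma vol_ball_lt_top : volume {g : V₁ × V₂ | Ng g < 1} < ⊤ := by
  apply lt_of_le_of_lt (measure_mono (t := Metric.closedBall 0 1) _)
  · exact (isCompact_closedBall _ _).measure_lt_top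
  · intro g hg
    simp only [Set.mem_ofPred_eq] at hg
    have h1 := norm_fst_le_Ng g
    have h2 := norm_snd_le_Ng g
    have h3 := Ng_nonneg g
    simp only [Metric.mem_closedBall, dist_zero_right, Prod.norm_def, sup_le_iff]
    constructor
    · linarith
    · nlinarith

lemma ball_open : IsOpen {g : V₁ × V₂ | Ng g < 1} := isOpen_lt Ng_cont continuous_const



noncomputable def HH (v F : V₁ × V₂ → ℝ) (g : V₁ × V₂) (r : ℝ) : ℝ :=
  Set.indicator {g : V₁ × V₂ | Ng g < 1} v g * F (dil r g) * r⁻¹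

open Classical in
noncomputable def HH' (Q : ℕ) (v F : V₁ × V₂ → ℝ) (g : V₁ × V₂) (r : ℝ) : ℝ :=
  (if Ng g < r then 1 else 0) * v g * F g * (r ^ (Q + 1))⁻¹

lemma HH'_dil (Q : ℕ) (v F : V₁ × V₂ → ℝ) (hv : ∀ r, 0 < r → ∀ g, v (dil r g) = v g)
    (g : V₁ × V₂) {r : ℝ} (hr : 0 < r) : HH' Q v F (dil r g) r = (r ^ Q)⁻¹ * HH v F g r := by
  unfold HH HH'
  rw [hv r hr, Ng_dil, abs_of_pos hr]
  have : r * Ng g < r ↔ Ng g < 1 := by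
    constructor
    · intro h; by_contra h'; nlinarith
    · intro h; nlinarith
  by_cases h : Ng g < 1
  · rw [if_pos (this.mpr h), Set.indicator_of_mem (s := {g : V₁ × V₂ | Ng g < 1}) (by simpa using h)]
    rw [pow_succ, mul_inv]; ring
  · rw [if_neg (fun h' => h (this.mp h')), Set.indicator_of_notMem (s := {g : V₁ × V₂ | Ng g < 1}) (by simpa using h)]
    simp

lemma ae_ne_zero [Nontrivial V₁] : ∀ᵐ g : V₁ × V₂, g ≠ (0, 0) := by
  have : (volume : Measure (V₁ × V₂)) {(0, 0)} = 0 := by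
    rw [Measure.volume_eq_prod, ← Set.singleton_prod_singleton, Measure.prod_prod, measure_singleton, zero_mul]
  exact measure_eq_zero_iff_ae_notMem.mp this

lemma polar [Nontrivial V₁] (Q : ℕ) (hQ : Q = Module.finrank ℝ V₁ + 2 * Module.finrank ℝ V₂) (hQ0 : 0 < Q)
    (v F : V₁ × V₂ → ℝ) (hvm : Measurable v) (hFm : Measurable F)
    (hv : ∀ r, 0 < r → ∀ g, v (dil r g) = v g)
    (hH : Integrable (Function.uncurry (HH v F)) (volume.prod (volume.restrict (Set.Ioi 0)))) :
    Integrable (fun g => v g * F g * (Ng g ^ Q)⁻¹) ∧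
      ∫ g, v g * F g * (Ng g ^ Q)⁻¹ = Q * ∫ g, ∫ r in Set.Ioi 0, HH v F g r := by
  have hNm : Measurable (Ng : V₁ × V₂ → ℝ) := Ng_cont.measurable
  have hm : Measurable (Function.uncurry (HH' Q v F)) := by
    unfold HH' Function.uncurry
    refine Measurable.mul (Measurable.mul (Measurable.mul ?_ (by fun_prop)) (by fun_prop)) (by fun_prop)
    refine Measurable.ite ?_ measurable_const measurable_const
    exact measurableSet_lt (by fun_prop) (by fun_prop)
  have hpos : ∀ᵐ r ∂(volume.restrict (Set.Ioi (0 : ℝ))), 0 < r := by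
    filter_upwards [ae_restrict_mem measurableSet_Ioi] with r hr using hr
  have key : ∀ r : ℝ, 0 < r → ∀ Φ : ℝ → ℝ, (∀ c x, 0 ≤ c → Φ (c * x) = c * Φ x) →
      ∫ g, Φ (HH' Q v F g r) = ∫ g, Φ (HH v F g r) := by
    intro r hr Φ hΦ
    have h1 := integral_dil hr (fun g => Φ (HH' Q v F g r))
    simp only [HH'_dil Q v F hv _ hr] at h1
    rw [← hQ] at h1
    have : ∀ g, Φ ((r ^ Q)⁻¹ * HH v F g r) = (r ^ Q)⁻¹ * Φ (HH v F g r) :=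
      fun g => hΦ _ _ (by positivity)
    simp only [this, integral_const_mul] at h1
    exact (mul_left_cancel₀ (by positivity) h1).symm
  have hH' : Integrable (Function.uncurry (HH' Q v F))
      (volume.prod (volume.restrict (Set.Ioi 0))) := by
    rw [integrable_prod_iff' hm.aestronglyMeasurable]
    rw [integrable_prod_iff' hH.aestronglyMeasurable] at hH
    constructor
    · filter_upwards [hH.1, hpos] with r h1 hr
      apply integrable_dil hr
      simp only [Function.uncurry_apply_pair, HH'_dil Q v F hv _ hr] at h1 ⊢
      exact h1.const_mul _
    · refine hH.2.congr ?_
      filter_upwards [hpos] with r hr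
      exact (key r hr (fun x => ‖x‖) (fun c x hc => by simp [abs_of_nonneg hc])).symm
  have hr : ∀ᵐ g : V₁ × V₂, ∫ r in Set.Ioi 0, HH' Q v F g r
      = (Q : ℝ)⁻¹ * (v g * F g * (Ng g ^ Q)⁻¹) := by
    filter_upwards [ae_ne_zero] with g hg
    have hN := Ng_pos hg
    have h1 : ∀ r ∈ Set.Ioi (0 : ℝ), HH' Q v F g r =
        Set.indicator (Set.Ioi (Ng g)) (fun r => v g * F g * r ^ (-((Q : ℝ) + 1))) r := by
      intro r hr
      unfold HH'
      have e : (r ^ (Q + 1))⁻¹ = r ^ (-((Q : ℝ) + 1)) := by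
        rw [Real.rpow_neg (le_of_lt hr), ← Real.rpow_natCast]; push_cast; rfl
      by_cases h : Ng g < r
      · rw [if_pos h, Set.indicator_of_mem (by exact h), e]; ring
      · rw [if_neg h, Set.indicator_of_notMem (by exact h)]; ring
    rw [setIntegral_congr_fun measurableSet_Ioi h1, setIntegral_indicator measurableSet_Ioi,
      Set.inter_eq_right.mpr (Set.Ioi_subset_Ioi hN.le), integral_const_mul,
      integral_Ioi_rpow_of_lt (by have : (0 : ℝ) < Q := by exact_mod_cast hQ0
                                  linarith) hN]
    have e2 : -((Q : ℝ) + 1) + 1 = -Q := by ring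
    rw [e2, Real.rpow_neg hN.le, Real.rpow_natCast, div_neg, neg_div, neg_neg]
    field_simp
  have hQ' : (Q : ℝ) ≠ 0 := by positivity
  constructor
  · have := (hH'.integral_prod_left.congr hr).const_mul (Q : ℝ)
    refine this.congr (Filter.Eventually.of_forall fun g => ?_)
    simp only
    field_simp
  · have h3 : ∫ r in Set.Ioi 0, ∫ g, HH v F g r = ∫ r in Set.Ioi 0, ∫ g, HH' Q v F g r :=
      (integral_congr_ae (μ := volume.restrict (Set.Ioi 0))
      (hpos.mono fun r hr => key r hr (fun x => x) (fun _ _ _ => rfl))).symm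
    rw [integral_integral_swap hH, h3]
    rw [← integral_integral_swap hH', integral_congr_ae hr, integral_const_mul]
    field_simp

lemma base_int (R : ℝ) (hR : 0 < R) : Integrable
    (fun p : (V₁ × V₂) × ℝ => Set.indicator {p : (V₁ × V₂) × ℝ | Ng p.1 < 1 ∧ p.2 * Ng p.1 < R}
      (fun p => Ng p.1) p) (volume.prod (volume.restrict (Set.Ioi 0))) := by
  have hNm : Measurable (Ng : V₁ × V₂ → ℝ) := Ng_cont.measurable
  have hs : MeasurableSet {p : (V₁ × V₂) × ℝ | Ng p.1 < 1 ∧ p.2 * Ng p.1 < R} :=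
    MeasurableSet.inter (s₁ := {p : (V₁ × V₂) × ℝ | Ng p.1 < 1}) (s₂ := {p : (V₁ × V₂) × ℝ | p.2 * Ng p.1 < R})
      (measurableSet_lt (by fun_prop) (by fun_prop)) (measurableSet_lt (by fun_prop) (by fun_prop))
  have hm : Measurable (fun p : (V₁ × V₂) × ℝ => Set.indicator
      {p : (V₁ × V₂) × ℝ | Ng p.1 < 1 ∧ p.2 * Ng p.1 < R} (fun p => Ng p.1) p) := by
    exact Measurable.indicator (by fun_prop) hs
  have sl : ∀ g : V₁ × V₂, Integrable (fun r : ℝ => Set.indicator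
      {p : (V₁ × V₂) × ℝ | Ng p.1 < 1 ∧ p.2 * Ng p.1 < R} (fun p => Ng p.1) (g, r))
      (volume.restrict (Set.Ioi 0)) ∧ ∫ r in Set.Ioi 0, ‖Set.indicator
      {p : (V₁ × V₂) × ℝ | Ng p.1 < 1 ∧ p.2 * Ng p.1 < R} (fun p => Ng p.1) (g, r)‖ ≤
        Set.indicator {g : V₁ × V₂ | Ng g < 1} (fun _ => R) g := by
    intro g
    by_cases h1 : Ng g < 1
    swap
    · have : ∀ r : ℝ, Set.indicator {p : (V₁ × V₂) × ℝ | Ng p.1 < 1 ∧ p.2 * Ng p.1 < R}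
          (fun p => Ng p.1) (g, r) = 0 := fun r => Set.indicator_of_notMem (fun h => h1 h.1) _
      simp [h1]
    rcases (Ng_nonneg g).eq_or_lt with h0 | h0
    · have : ∀ r : ℝ, Set.indicator {p : (V₁ × V₂) × ℝ | Ng p.1 < 1 ∧ p.2 * Ng p.1 < R}
          (fun p => Ng p.1) (g, r) = 0 := fun r => by
        rw [Set.indicator_apply]; split_ifs <;> simp [← h0]
      simp [this]
      exact Set.indicator_nonneg (fun _ _ => hR.le) _
    have : ∀ r : ℝ, Set.indicator {p : (V₁ × V₂) × ℝ | Ng p.1 < 1 ∧ p.2 * Ng p.1 < R}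
          (fun p => Ng p.1) (g, r) = Set.indicator (Set.Iio (R / Ng g)) (fun _ => Ng g) r := by
      intro r
      simp only [Set.indicator_apply]
      have : ((g, r) ∈ {p : (V₁ × V₂) × ℝ | Ng p.1 < 1 ∧ p.2 * Ng p.1 < R}) ↔
          r ∈ Set.Iio (R / Ng g) := by
        simp [h1, lt_div_iff₀ h0]
      simp [this]
    have e : Set.Ioi 0 ∩ Set.Iio (R / Ng g) = Set.Ioo 0 (R / Ng g) := rfl
    simp only [this]
    constructor
    · rw [integrable_indicator_iff measurableSet_Iio, IntegrableOn, Measure.restrict_restrict measurableSet_Iio,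
        Set.inter_comm, e]
      exact integrable_const _
    · simp only [norm_indicator_eq_indicator_norm]
      rw [setIntegral_indicator measurableSet_Iio, e]
      have h2 : 0 ≤ R / Ng g := by positivity
      simp [h1, abs_of_pos h0, h2]
      field_simp
      rfl
  rw [integrable_prod_iff hm.aestronglyMeasurable]
  refine ⟨Filter.Eventually.of_forall fun g => (sl g).1, ?_⟩
  refine Integrable.mono' (g := Set.indicator {g : V₁ × V₂ | Ng g < 1} (fun _ => R)) ?_ ?_ ?_
  · rw [integrable_indicator_iff ball_open.measurableSet]
    exact integrableOn_const vol_ball_lt_top.ne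
  · exact (hm.norm.stronglyMeasurable.integral_prod_right' (f := _)).aestronglyMeasurable
  · refine Filter.Eventually.of_forall fun g => ?_
    rw [Real.norm_of_nonneg (integral_nonneg fun _ => norm_nonneg _)]
    exact (sl g).2


noncomputable def Zf (φ : V₁ × V₂ → ℝ) (g : V₁ × V₂) : ℝ := fderiv ℝ φ g (g.1, (2 : ℝ) • g.2)

lemma inner_Xgrad (b : V₁ →ₗ[ℝ] V₁ →ₗ[ℝ] V₂) (f : V₁ × V₂ → ℝ) (g : V₁ × V₂) (v : V₁) :
    ⟪Xgrad b f g, v⟫ = fderiv ℝ f g (v, (2⁻¹ : ℝ) • b g.1 v) := by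
  unfold Xgrad
  rw [InnerProductSpace.toDual_symm_apply]
  rfl

lemma hasFDerivAt_aF (g : V₁ × V₂) : ∃ L : V₁ × V₂ →L[ℝ] ℝ, HasFDerivAt (aF : V₁ × V₂ → ℝ) L g ∧
    ∀ v s, L (v, s) = 4 * ‖g.1‖ ^ 2 * ⟪g.1, v⟫ + 32 * ⟪g.2, s⟫ := by
  have h1 := (hasFDerivAt_fst (𝕜 := ℝ) (p := g)).norm_sq
  have h2 := (hasFDerivAt_snd (𝕜 := ℝ) (p := g)).norm_sq
  refine ⟨_, (h1.pow 2).add (h2.const_mul 16), ?_⟩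
  intro v s
  simp
  ring

lemma Xgrad_comp (b : V₁ →ₗ[ℝ] V₁ →ₗ[ℝ] V₂)
    (J : V₂ → V₁ →ₗ[ℝ] V₁) (hJ : ∀ (t : V₂) (z z' : V₁), ⟪J t z, z'⟫ = ⟪b z z', t⟫)
    (f : V₁ × V₂ → ℝ) (h : ℝ → ℝ) (d : ℝ) (g : V₁ × V₂) (hd : HasDerivAt h d (aF g))
    (hf : f =ᶠ[nhds g] fun g => h (aF g)) : Xgrad b f g = (4 * d) • Ag J g := by
  obtain ⟨L, hL, hL'⟩ := hasFDerivAt_aF g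
  have h1 : fderiv ℝ f g = d • L := by
    rw [hf.fderiv_eq]
    exact (hd.comp_hasFDerivAt g hL).fderiv
  refine ext_inner_right ℝ fun v => ?_
  rw [inner_Xgrad, h1]
  simp only [smul_apply, hL', smul_eq_mul, Ag, inner_smul_left, inner_add_left,
    inner_smul_right, hJ]
  rw [real_inner_comm g.2]
  simp
  ring

lemma b_self (b : V₁ →ₗ[ℝ] V₁ →ₗ[ℝ] V₂) (hskew : ∀ z z' : V₁, b z z' = - b z' z) (z : V₁) :
    b z z = 0 := by
  have h : (2 : ℝ) • b z z = 0 := by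
    rw [two_smul]
    exact add_eq_zero_iff_eq_neg.mpr (hskew z z)
  simpa using h

lemma inner_J_self (b : V₁ →ₗ[ℝ] V₁ →ₗ[ℝ] V₂) (hskew : ∀ z z' : V₁, b z z' = - b z' z)
    (J : V₂ → V₁ →ₗ[ℝ] V₁) (hJ : ∀ (t : V₂) (z z' : V₁), ⟪J t z, z'⟫ = ⟪b z z', t⟫)
    (t : V₂) (z : V₁) : ⟪J t z, z⟫ = 0 := by
  have h : b z z = 0 := b_self b hskew z
  rw [hJ, h, inner_zero_left]

lemma norm_Ag (b : V₁ →ₗ[ℝ] V₁ →ₗ[ℝ] V₂) (hskew : ∀ z z' : V₁, b z z' = - b z' z)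
    (J : V₂ → V₁ →ₗ[ℝ] V₁) (hJ : ∀ (t : V₂) (z z' : V₁), ⟪J t z, z'⟫ = ⟪b z z', t⟫)
    (hH : ∀ (t : V₂) (z : V₁), ‖J t z‖ = ‖t‖ * ‖z‖) (g : V₁ × V₂) :
    ‖Ag J g‖ = ‖g.1‖ * Ng g ^ 2 := by
  apply (pow_left_inj₀ (norm_nonneg _) (by positivity) (n := 2) (by norm_num)).mp
  have h1 := inner_J_self b hskew J hJ g.2 g.1
  have h2 : (‖g.1‖ * Ng g ^ 2) ^ 2 = ‖g.1‖ ^ 2 * aF g := by rw [← Ng_pow]; ring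
  rw [h2]
  unfold Ag aF psiF chiF
  rw [norm_add_sq_real, inner_smul_left, inner_smul_right, real_inner_comm, h1, norm_smul, norm_smul, hH]
  simp
  ring

lemma b_J (b : V₁ →ₗ[ℝ] V₁ →ₗ[ℝ] V₂)
    (J : V₂ → V₁ →ₗ[ℝ] V₁) (hJ : ∀ (t : V₂) (z z' : V₁), ⟪J t z, z'⟫ = ⟪b z z', t⟫)
    (hH : ∀ (t : V₂) (z : V₁), ‖J t z‖ = ‖t‖ * ‖z‖) (t : V₂) (z : V₁) :
    b z (J t z) = ‖z‖ ^ 2 • t := by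
  refine ext_inner_right ℝ fun s => ?_
  rw [← hJ, inner_smul_left]
  have h1 : J (s + t) z = J s z + J t z := by
    refine ext_inner_right ℝ fun w => ?_
    rw [inner_add_left, hJ, hJ, hJ, inner_add_right]
  have h2 := norm_add_sq_real (J s z) (J t z)
  rw [← h1, hH, hH, hH, mul_pow, norm_add_sq_real] at h2
  simp
  rw [real_inner_comm t] at h2
  linarith

lemma inner_Ag (b : V₁ →ₗ[ℝ] V₁ →ₗ[ℝ] V₂) (hskew : ∀ z z' : V₁, b z z' = - b z' z)
    (J : V₂ → V₁ →ₗ[ℝ] V₁) (hJ : ∀ (t : V₂) (z z' : V₁), ⟪J t z, z'⟫ = ⟪b z z', t⟫)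
    (hH : ∀ (t : V₂) (z : V₁), ‖J t z‖ = ‖t‖ * ‖z‖) (φ : V₁ × V₂ → ℝ) (g : V₁ × V₂) :
    ⟪Ag J g, Xgrad b φ g⟫ = ‖g.1‖ ^ 2 * Zf φ g + 4 * fderiv ℝ φ g (J g.2 g.1, 0) := by
  have h : b g.1 g.1 = 0 := b_self b hskew _
  rw [real_inner_comm, inner_Xgrad]
  have : ((Ag J g, (2⁻¹ : ℝ) • b g.1 (Ag J g)) : V₁ × V₂) =
      ‖g.1‖ ^ 2 • (g.1, (2 : ℝ) • g.2) + (4 : ℝ) • (J g.2 g.1, 0) := by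
    ext
    · simp [Ag]
    · simp only [Ag, map_add, map_smul, h, b_J b J hJ hH]
      simp [smul_smul]
      congr 1; ring
  rw [this, map_add, map_smul, map_smul]
  rfl

lemma Xgrad_Ng (b : V₁ →ₗ[ℝ] V₁ →ₗ[ℝ] V₂) (hskew : ∀ z z' : V₁, b z z' = - b z' z)
    (J : V₂ → V₁ →ₗ[ℝ] V₁) (hJ : ∀ (t : V₂) (z z' : V₁), ⟪J t z, z'⟫ = ⟪b z z', t⟫)
    (hH : ∀ (t : V₂) (z : V₁), ‖J t z‖ = ‖t‖ * ‖z‖) (g : V₁ × V₂) (hg : g ≠ (0, 0)) :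
    ‖Xgrad b Ng g‖ = ‖g.1‖ / Ng g := by
  have ha := aF_pos hg
  have hN := Ng_pos hg
  rw [Xgrad_comp b J hJ Ng (fun x => x ^ ((1 : ℝ) / 4)) _ g
    (Real.hasDerivAt_rpow_const (Or.inl ha.ne')) (Filter.Eventually.of_forall fun _ => rfl),
    norm_smul, norm_Ag b hskew J hJ hH]
  have e : aF g ^ ((1 : ℝ) / 4 - 1) = (Ng g ^ 3)⁻¹ := by
    rw [Real.rpow_sub_one ha.ne', ← Ng_pow]
    have : (Ng g ^ 4) ^ ((1 : ℝ) / 4) = Ng g := by rw [Ng_pow]; rfl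
    change (Ng g ^ 4) ^ ((1 : ℝ) / 4) / _ = _
    rw [this]; field_simp
  rw [e, Real.norm_of_nonneg (by positivity)]
  field_simp

lemma Xgrad_log (b : V₁ →ₗ[ℝ] V₁ →ₗ[ℝ] V₂)
    (J : V₂ → V₁ →ₗ[ℝ] V₁) (hJ : ∀ (t : V₂) (z z' : V₁), ⟪J t z, z'⟫ = ⟪b z z', t⟫)
    (c : ℝ) (f : V₁ × V₂ → ℝ) (hf : ∀ g : V₁ × V₂, g ≠ (0, 0) → f g = - c * Real.log (Ng g))
    (g : V₁ × V₂) (hg : g ≠ (0, 0)) :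
    Xgrad b f g = (- c * (Ng g ^ 4)⁻¹) • Ag J g := by
  have ha := aF_pos hg
  rw [Xgrad_comp b J hJ f (fun x => - c * (1 / 4 * Real.log x)) _ g
    (((Real.hasDerivAt_log ha.ne').const_mul _).const_mul _), Ng_pow]
  · congr 1; ring
  · filter_upwards [isOpen_ne.mem_nhds hg] with x hx
    rw [hf x hx, Ng, Real.log_rpow (aF_pos hx)]

lemma J_cont (b : V₁ →ₗ[ℝ] V₁ →ₗ[ℝ] V₂)
    (J : V₂ → V₁ →ₗ[ℝ] V₁) (hJ : ∀ (t : V₂) (z z' : V₁), ⟪J t z, z'⟫ = ⟪b z z', t⟫) :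
    Continuous (fun g : V₁ × V₂ => J g.2 g.1) := by
  have : (fun g : V₁ × V₂ => J g.2 g.1) = fun g => ∑ i, ⟪b.flip (stdOrthonormalBasis ℝ V₁ i) g.1, g.2⟫ •
      stdOrthonormalBasis ℝ V₁ i := by
    funext g
    conv_lhs => rw [← (stdOrthonormalBasis ℝ V₁).sum_repr' (J g.2 g.1)]
    refine Finset.sum_congr rfl fun i _ => ?_
    rw [real_inner_comm, hJ]; rfl
  rw [this]
  refine continuous_finsetSum _ fun i _ => ?_
  have := LinearMap.continuous_of_finiteDimensional (b.flip (stdOrthonormalBasis ℝ V₁ i))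
  fun_prop

lemma supp_bound (φ : V₁ × V₂ → ℝ) (hφ : ContDiff ℝ (⊤ : ℕ∞) φ) (hc : HasCompactSupport φ) :
    ∃ R > 0, ∃ C ≥ 0, ∀ g, ‖fderiv ℝ φ g‖ ≤ C ∧ (R ≤ Ng g → φ g = 0 ∧ fderiv ℝ φ g = 0) := by
  have hcont : Continuous (fderiv ℝ φ) := hφ.continuous_fderiv (by simp)
  have hK : IsCompact (tsupport φ) := hc
  obtain ⟨C, hC⟩ := hK.exists_bound_of_continuousOn (f := fderiv ℝ φ) hcont.continuousOn
  obtain ⟨R, hR⟩ := hK.exists_bound_of_continuousOn (f := Ng) Ng_cont.continuousOn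
  have h0 : ∀ g, g ∉ tsupport φ → fderiv ℝ φ g = 0 := fun g hg => by
    by_contra h
    exact hg (support_fderiv_subset ℝ h)
  have h1 : ∀ g, g ∉ tsupport φ → φ g = 0 := fun g hg => image_eq_zero_of_notMem_tsupport hg
  refine ⟨|R| + 1, by positivity, |C|, abs_nonneg C, fun g => ⟨?_, fun h => ?_⟩⟩
  · by_cases hg : g ∈ tsupport φ
    · exact (hC g hg).trans (le_abs_self C)
    · rw [h0 g hg, ContinuousLinearMap.opNorm_zero]; exact abs_nonneg C
  · have hg : g ∉ tsupport φ := by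
      intro hg
      have h2 := hR g hg
      rw [Real.norm_of_nonneg (Ng_nonneg g)] at h2
      linarith [le_abs_self R]
    exact ⟨h1 g hg, h0 g hg⟩

lemma gauge_int [Nontrivial V₁] (Q : ℕ) (hQ : Q = Module.finrank ℝ V₁ + 2 * Module.finrank ℝ V₂)
    (hQ0 : 0 < Q) (R : ℝ) (hR : 0 < R) :
    Integrable (fun g : V₁ × V₂ => Set.indicator {g : V₁ × V₂ | Ng g < R} Ng g * (Ng g ^ Q)⁻¹) := by
  have hNm : Measurable (Ng : V₁ × V₂ → ℝ) := Ng_cont.measurable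
  have := (polar Q hQ hQ0 (fun _ => 1) (Set.indicator {g : V₁ × V₂ | Ng g < R} Ng) measurable_const
    (hNm.indicator (measurableSet_lt hNm measurable_const)) (fun _ _ _ => rfl) ?_).1
  · simpa using this
  · refine (base_int R hR).congr ?_
    have : ∀ᵐ p : (V₁ × V₂) × ℝ ∂(volume.prod (volume.restrict (Set.Ioi 0))), 0 < p.2 :=
      Measure.quasiMeasurePreserving_snd.ae (ae_restrict_mem measurableSet_Ioi)
    filter_upwards [this] with p hp
    obtain ⟨g, r⟩ := p
    simp only at hp
    simp only [Function.uncurry_apply_pair, HH, Set.indicator_apply, Set.mem_ofPred_eq, Ng_dil, abs_of_pos hp]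
    by_cases h1 : Ng g < 1 <;> by_cases h2 : r * Ng g < R <;> simp [h1, h2]
    field_simp

lemma dil_hasDerivAt (φ : V₁ × V₂ → ℝ) (hφ : ContDiff ℝ (⊤ : ℕ∞) φ) (g : V₁ × V₂) (r : ℝ) :
    HasDerivAt (fun r => φ (dil r g)) (fderiv ℝ φ (dil r g) (g.1, (2 * r) • g.2)) r := by
  have h1 : HasDerivAt (fun r : ℝ => dil r g) (g.1, (2 * r) • g.2) r := by
    unfold dil
    refine HasDerivAt.prodMk ?_ ?_
    · simpa using (hasDerivAt_id r).smul_const g.1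
    · simpa using (hasDerivAt_pow 2 r).smul_const g.2
  exact ((hφ.differentiable (by simp)) (dil r g)).hasFDerivAt.comp_hasDerivAt r h1

lemma Zf_dil (φ : V₁ × V₂ → ℝ) (g : V₁ × V₂) {r : ℝ} (hr : 0 < r) :
    Zf φ (dil r g) * r⁻¹ = fderiv ℝ φ (dil r g) (g.1, (2 * r) • g.2) := by
  unfold Zf
  rw [mul_comm, ← smul_eq_mul, ← map_smul]
  congr 1
  simp only [dil, Prod.smul_mk, smul_smul]
  congr 2
  · rw [inv_mul_cancel₀ hr.ne', one_smul]
  · field_simp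

lemma Zf_int (φ : V₁ × V₂ → ℝ) (hφ : ContDiff ℝ (⊤ : ℕ∞) φ) (hc : HasCompactSupport φ)
    (g : V₁ × V₂) (hg : g ≠ (0, 0)) :
    ∫ r in Set.Ioi 0, Zf φ (dil r g) * r⁻¹ = - φ (0, 0) := by
  obtain ⟨R, hR, C, hC, hb⟩ := supp_bound φ hφ hc
  have hN := Ng_pos hg
  have hcd : ContDiff ℝ 1 (fun r => φ (dil r g)) := by
    refine (hφ.of_le (by exact_mod_cast le_top)).comp ?_
    unfold dil; fun_prop
  have hcs : HasCompactSupport (fun r => φ (dil r g)) := by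
    refine HasCompactSupport.intro (isCompact_closedBall (0 : ℝ) (R / Ng g)) fun r hr => ?_
    refine ((hb _).2 ?_).1
    rw [Ng_dil]
    simp only [Metric.mem_closedBall, dist_zero_right, Real.norm_eq_abs, not_le] at hr
    rw [div_lt_iff₀ hN] at hr
    exact hr.le
  have h := hcs.integral_Ioi_deriv_eq hcd 0
  have e : dil 0 g = (0, 0) := by simp [dil]
  rw [e] at h
  rw [← h]
  refine setIntegral_congr_fun measurableSet_Ioi fun r hr => ?_
  rw [(dil_hasDerivAt φ hφ g r).deriv, Zf_dil φ g hr]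

lemma Zf_bound (φ : V₁ × V₂ → ℝ) (hφ : ContDiff ℝ (⊤ : ℕ∞) φ) (hc : HasCompactSupport φ) :
    ∃ R > 0, ∃ C ≥ 0, ∀ g, |Zf φ g| ≤ C * Set.indicator {g : V₁ × V₂ | Ng g < R} Ng g := by
  obtain ⟨R, hR, C, hC, hb⟩ := supp_bound φ hφ hc
  refine ⟨R, hR, C * (1 + R), by positivity, fun g => ?_⟩
  by_cases h : Ng g < R
  · rw [Set.indicator_of_mem (by exact h)]
    have h1 := norm_fst_le_Ng g
    have h2 := norm_snd_le_Ng g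
    have h3 := Ng_nonneg g
    have h4 : ‖((g.1, (2 : ℝ) • g.2) : V₁ × V₂)‖ ≤ (1 + R) * Ng g := by
      rw [Prod.norm_def]
      simp only [norm_smul, Real.norm_ofNat, sup_le_iff]
      constructor <;> nlinarith [norm_nonneg g.2]
    have h5 := (fderiv ℝ φ g).le_opNorm (g.1, (2 : ℝ) • g.2)
    calc |Zf φ g| ≤ ‖fderiv ℝ φ g‖ * ‖((g.1, (2 : ℝ) • g.2) : V₁ × V₂)‖ := h5
      _ ≤ C * ((1 + R) * Ng g) := by gcongr; exact (hb g).1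
      _ = _ := by ring
  · rw [Set.indicator_of_notMem (by exact h)]
    simp [Zf, ((hb g).2 (not_lt.mp h)).2]

lemma dil_main [Nontrivial V₁] (Q : ℕ) (hQ : Q = Module.finrank ℝ V₁ + 2 * Module.finrank ℝ V₂)
    (hQ0 : 0 < Q) (φ : V₁ × V₂ → ℝ) (hφ : ContDiff ℝ (⊤ : ℕ∞) φ) (hc : HasCompactSupport φ)
    (v : V₁ × V₂ → ℝ) (hvm : Measurable v) (hv : ∀ r, 0 < r → ∀ g, v (dil r g) = v g)
    (hv1 : ∀ g, |v g| ≤ 1) :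
    Integrable (fun g => v g * Zf φ g * (Ng g ^ Q)⁻¹) ∧
      ∫ g, v g * Zf φ g * (Ng g ^ Q)⁻¹ =
        - (Q * (∫ g in {g : V₁ × V₂ | Ng g < 1}, v g) * φ (0, 0)) := by
  have hcont : Continuous (fderiv ℝ φ) := hφ.continuous_fderiv (by simp)
  have hZm : Measurable (Zf φ) := by
    have : Continuous (Zf φ) := by
      unfold Zf
      exact hcont.clm_apply (by fun_prop)
    exact this.measurable
  have hbm : MeasurableSet {g : V₁ × V₂ | Ng g < 1} := ball_open.measurableSet
  obtain ⟨R, hR, C, hC, hb⟩ := Zf_bound φ hφ hc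
  obtain ⟨h1, h2⟩ := polar Q hQ hQ0 v (Zf φ) hvm hZm hv (by
    refine Integrable.mono' ((base_int R hR).const_mul C) ?_ ?_
    · have : Measurable (Function.uncurry (HH v (Zf φ))) := by
        unfold HH Function.uncurry
        refine Measurable.mul (Measurable.mul ?_ ?_) (by fun_prop)
        · exact (hvm.indicator hbm).comp measurable_fst
        · exact hZm.comp dil_cont.measurable
      exact this.aestronglyMeasurable
    have : ∀ᵐ p : (V₁ × V₂) × ℝ ∂(volume.prod (volume.restrict (Set.Ioi 0))), 0 < p.2 :=
      Measure.quasiMeasurePreserving_snd.ae (ae_restrict_mem measurableSet_Ioi)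
    filter_upwards [this] with p hp
    obtain ⟨g, r⟩ := p
    simp only at hp
    have hb' := hb (dil r g)
    simp only [Function.uncurry_apply_pair, HH, Set.indicator_apply, Set.mem_ofPred_eq, Ng_dil, abs_of_pos hp,
      Real.norm_eq_abs, abs_mul, abs_inv] at hb' ⊢
    by_cases hg : Ng g < 1
    · rw [if_pos hg]
      calc |v g| * |Zf φ (dil r g)| * r⁻¹
          ≤ 1 * (C * if r * Ng g < R then r * Ng g else 0) * r⁻¹ := by
            gcongr; exact hv1 g
        _ = _ := by
            by_cases h2 : r * Ng g < R <;> simp [hg, h2]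
            field_simp
    · simp [hg])
  refine ⟨h1, ?_⟩
  rw [h2]
  have : ∫ g, ∫ r in Set.Ioi 0, HH v (Zf φ) g r =
      ∫ g, Set.indicator {g : V₁ × V₂ | Ng g < 1} v g * (- φ (0, 0)) := by
    refine integral_congr_ae ?_
    filter_upwards [ae_ne_zero] with g hg
    rw [← Zf_int φ hφ hc g hg, ← integral_const_mul]
    refine integral_congr_ae (Filter.Eventually.of_forall fun r => ?_)
    simp only [HH, mul_assoc]
  rw [this, integral_mul_const, integral_indicator hbm]
  ring

lemma rot_main {f : V₁ → ℝ} (hf : ContDiff ℝ 1 f) (hc : HasCompactSupport f)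
    (K : V₁ →ₗ[ℝ] V₁) (hK : ∀ z, ‖K z‖ = ‖z‖) (hK2 : ∀ z, K (K z) = - z)
    (ρ : ℝ → ℝ) (hρ : Continuous ρ) : ∫ z, ρ ‖z‖ * fderiv ℝ f z (K z) = 0 := by
  have hKc : Continuous K := K.continuous_of_finiteDimensional
  have hK0 : ∀ z, ⟪z, K z⟫ = 0 := by
    intro z
    have h1 : ⟪K z, K (K z)⟫ = ⟪z, K z⟫ :=
      (LinearIsometry.mk K hK).inner_map_map z (K z)
    rw [hK2, inner_neg_right, real_inner_comm] at h1
    linarith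
  let L : ℝ → V₁ →ₗ[ℝ] V₁ := fun s => Real.cos s • LinearMap.id + Real.sin s • K
  have hLa : ∀ s z, L s z = Real.cos s • z + Real.sin s • K z := fun s z => by simp [L]
  have hL : ∀ s z, ‖L s z‖ = ‖z‖ := by
    intro s z
    apply (pow_left_inj₀ (norm_nonneg _) (norm_nonneg _) (n := 2) (by norm_num)).mp
    rw [hLa, norm_add_sq_real, norm_smul, norm_smul, hK, inner_smul_left, inner_smul_right, hK0]
    simp only [Real.norm_eq_abs, mul_pow, sq_abs]
    have := Real.sin_sq_add_cos_sq s
    linear_combination ‖z‖ ^ 2 * this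
  have hrot : ∀ s, ∫ z, ρ ‖z‖ * fderiv ℝ f (L s z) (K (L s z)) = ∫ z, ρ ‖z‖ * fderiv ℝ f z (K z) := by
    intro s
    let e := (LinearIsometry.mk (L s) (hL s)).toLinearIsometryEquiv rfl
    have := e.measurePreserving.integral_comp e.toHomeomorph.measurableEmbedding
      (fun z => ρ ‖z‖ * fderiv ℝ f z (K z))
    rw [← this]
    refine integral_congr_ae (Filter.Eventually.of_forall fun z => ?_)
    have he : e z = L s z := rfl
    simp only [he, hL]
  have hfc : Continuous (fderiv ℝ f) := hf.continuous_fderiv (by simp)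
  have hLc : Continuous (fun p : ℝ × V₁ => L p.1 p.2) := by
    simp only [hLa]; fun_prop
  have hder : ∀ z s, HasDerivAt (fun s => f (L s z)) (fderiv ℝ f (L s z) (K (L s z))) s := by
    intro z s
    have h1 : HasDerivAt (fun s => L s z) (K (L s z)) s := by
      simp only [hLa]
      have h2 := ((Real.hasDerivAt_cos s).smul_const z).add ((Real.hasDerivAt_sin s).smul_const (K z))
      have h3 : K (Real.cos s • z + Real.sin s • K z) = -Real.sin s • z + Real.cos s • K z := by
        rw [map_add, map_smul, map_smul, hK2]
        simp; abel
      rw [h3]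
      exact h2
    exact ((hf.differentiable (by simp)) _).hasFDerivAt.comp_hasDerivAt s h1
  obtain ⟨r, hr⟩ := hc.isCompact.isBounded.subset_closedBall (0 : V₁)
  have hzero : ∀ z, r < ‖z‖ → fderiv ℝ f z = 0 := fun z hz =>
    image_eq_zero_of_notMem_tsupport fun h => by
      have := hr (tsupport_fderiv_subset ℝ h)
      simp at this
      linarith
  have hGc : Continuous (fun p : ℝ × V₁ => ρ ‖p.2‖ * fderiv ℝ f (L p.1 p.2) (K (L p.1 p.2))) := by
    refine Continuous.mul (by fun_prop) ?_
    exact (hfc.comp hLc).clm_apply (hKc.comp hLc)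
  have hint : Integrable (Function.uncurry fun (s : ℝ) (z : V₁) =>
      ρ ‖z‖ * fderiv ℝ f (L s z) (K (L s z)))
      ((volume.restrict (Set.uIoc 0 (2 * Real.pi))).prod volume) := by
    have h1 : IntegrableOn (Function.uncurry fun (s : ℝ) (z : V₁) =>
        ρ ‖z‖ * fderiv ℝ f (L s z) (K (L s z)))
        (Set.uIcc 0 (2 * Real.pi) ×ˢ Metric.closedBall 0 r) (volume.prod volume) :=
      hGc.continuousOn.integrableOn_compact (isCompact_uIcc.prod (isCompact_closedBall _ _))
    have h2 : IntegrableOn (Function.uncurry fun (s : ℝ) (z : V₁) =>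
        ρ ‖z‖ * fderiv ℝ f (L s z) (K (L s z)))
        (Set.uIoc 0 (2 * Real.pi) ×ˢ Set.univ) (volume.prod volume) := by
      refine IntegrableOn.of_forall_sdiff_eq_zero (h1.mono_set (Set.prod_mono_left Set.uIoc_subset_uIcc))
        (measurableSet_uIoc.prod MeasurableSet.univ) ?_
      rintro ⟨s, z⟩ ⟨h, h'⟩
      have : r < ‖z‖ := by
        by_contra h3
        exact h' ⟨h.1, by simpa using h3⟩
      simp [Function.uncurry, hzero (L s z) (by rw [hL]; exact this)]
    rw [IntegrableOn, ← Measure.prod_restrict, Measure.restrict_univ] at h2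
    exact h2
  have hsw := intervalIntegral_integral_swap hint
  simp only [hrot] at hsw
  have h0 : ∀ z, ∫ s in (0 : ℝ)..(2 * Real.pi), ρ ‖z‖ * fderiv ℝ f (L s z) (K (L s z)) = 0 := by
    intro z
    rw [intervalIntegral.integral_const_mul, intervalIntegral.integral_eq_sub_of_hasDerivAt
      (fun s _ => hder z s)]
    · simp [hLa]
    · apply Continuous.intervalIntegrable
      have hz : Continuous (fun s => L s z) := by simp only [hLa]; fun_prop
      exact (hfc.comp hz).clm_apply (hKc.comp hz)
  simp only [h0] at hsw
  simpa [Real.pi_ne_zero] using hsw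

lemma J_J (b : V₁ →ₗ[ℝ] V₁ →ₗ[ℝ] V₂) (hskew : ∀ z z' : V₁, b z z' = - b z' z)
    (J : V₂ → V₁ →ₗ[ℝ] V₁) (hJ : ∀ (t : V₂) (z z' : V₁), ⟪J t z, z'⟫ = ⟪b z z', t⟫)
    (hH : ∀ (t : V₂) (z : V₁), ‖J t z‖ = ‖t‖ * ‖z‖) (t : V₂) (z : V₁) :
    J t (J t z) = - (‖t‖ ^ 2 • z) := by
  refine ext_inner_right ℝ fun w => ?_
  rw [hJ, hskew, inner_neg_left, inner_neg_left, ← hJ, inner_smul_left]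
  have h2 := norm_add_sq_real (J t w) (J t z)
  rw [← map_add, hH, hH, hH, mul_pow, norm_add_sq_real, real_inner_comm z] at h2
  simp
  linarith

lemma rot_int (b : V₁ →ₗ[ℝ] V₁ →ₗ[ℝ] V₂) (hskew : ∀ z z' : V₁, b z z' = - b z' z)
    (J : V₂ → V₁ →ₗ[ℝ] V₁) (hJ : ∀ (t : V₂) (z z' : V₁), ⟪J t z, z'⟫ = ⟪b z z', t⟫)
    (hH : ∀ (t : V₂) (z : V₁), ‖J t z‖ = ‖t‖ * ‖z‖)
    (φ : V₁ × V₂ → ℝ) (hφ : ContDiff ℝ (⊤ : ℕ∞) φ) (hc : HasCompactSupport φ) (q : ℕ)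
    (hI : Integrable (fun g : V₁ × V₂ =>
      ‖g.1‖ ^ q * (Ng g ^ (2 * (q + 2)))⁻¹ * fderiv ℝ φ g (J g.2 g.1, 0))) :
    ∫ g : V₁ × V₂, ‖g.1‖ ^ q * (Ng g ^ (2 * (q + 2)))⁻¹ * fderiv ℝ φ g (J g.2 g.1, 0) = 0 := by
  rw [Measure.volume_eq_prod] at hI ⊢
  rw [integral_prod_symm _ hI]
  refine integral_eq_zero_of_ae (Filter.Eventually.of_forall fun t => ?_)
  simp only [Pi.zero_apply]
  rcases eq_or_ne t 0 with h0 | h0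
  · have : ∀ z, J t z = 0 := fun z => by rw [← norm_eq_zero, hH, h0]; simp
    have h : ∀ z : V₁, fderiv ℝ φ (z, t) (J t z, 0) = 0 := fun z => by
      rw [this]; exact map_zero _
    simp [h]
  have ht : 0 < ‖t‖ := norm_pos_iff.mpr h0
  obtain ⟨R, hR, C, hC, hb⟩ := supp_bound φ hφ hc
  have hder : ∀ z w, fderiv ℝ (fun z => φ (z, t)) z w = fderiv ℝ φ (z, t) (w, 0) := by
    intro z w
    have h1 := ((hφ.differentiable (by simp)) (z, t)).hasFDerivAt.comp z (hasFDerivAt_prodMk_left (𝕜 := ℝ) z t)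
    have h2 : fderiv ℝ (fun z => φ (z, t)) z = _ := h1.fderiv
    rw [h2]
    rfl
  have := rot_main (f := fun z => φ (z, t)) ((hφ.of_le (by exact_mod_cast le_top)).comp (by fun_prop))
    (HasCompactSupport.intro (isCompact_closedBall (0 : V₁) R) fun z hz => ((hb _).2 (by
      simp at hz
      exact hz.le.trans (norm_fst_le_Ng (z, t)))).1)
    (‖t‖⁻¹ • J t) (fun z => by simp [norm_smul, hH, h0])
    (fun z => by
      simp [J_J b hskew J hJ hH, smul_smul]
      field_simp
      simp)
    (fun x => ‖t‖ * (x ^ q * ((((x ^ 2) ^ 2 + 16 * ‖t‖ ^ 2) ^ ((1 : ℝ) / 4)) ^ (2 * (q + 2)))⁻¹)) (by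
      have hp : ∀ x : ℝ, 0 < (x ^ 2) ^ 2 + 16 * ‖t‖ ^ 2 := fun x => by positivity
      refine continuous_const.mul ((continuous_pow q).mul (Continuous.inv₀ (Continuous.pow
        (Continuous.rpow_const (by fun_prop) (fun x => Or.inl (hp x).ne')) _) ?_))
      intro x
      have := Real.rpow_pos_of_pos (hp x) ((1 : ℝ) / 4)
      positivity)
  rw [← this]
  refine integral_congr_ae (Filter.Eventually.of_forall fun z => ?_)
  simp only
  rw [hder]
  have e : (((‖t‖⁻¹ • J t) z, 0) : V₁ × V₂) = ‖t‖⁻¹ • (J t z, 0) := by simp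
  rw [e, map_smul]
  simp only [Ng, aF, psiF, chiF, smul_eq_mul]
  field_simp

lemma rot_integrable [Nontrivial V₁] (b : V₁ →ₗ[ℝ] V₁ →ₗ[ℝ] V₂)
    (J : V₂ → V₁ →ₗ[ℝ] V₁) (hJ : ∀ (t : V₂) (z z' : V₁), ⟪J t z, z'⟫ = ⟪b z z', t⟫)
    (hH : ∀ (t : V₂) (z : V₁), ‖J t z‖ = ‖t‖ * ‖z‖)
    (φ : V₁ × V₂ → ℝ) (hφ : ContDiff ℝ (⊤ : ℕ∞) φ) (hc : HasCompactSupport φ) (q : ℕ)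
    (hQ : q + 2 = Module.finrank ℝ V₁ + 2 * Module.finrank ℝ V₂) :
    Integrable (fun g : V₁ × V₂ =>
      ‖g.1‖ ^ q * (Ng g ^ (2 * (q + 2)))⁻¹ * fderiv ℝ φ g (J g.2 g.1, 0)) := by
  obtain ⟨R, hR, C, hC, hb⟩ := supp_bound φ hφ hc
  have hcont : Continuous (fderiv ℝ φ) := hφ.continuous_fderiv (by simp)
  have hNm : Measurable (Ng : V₁ × V₂ → ℝ) := Ng_cont.measurable
  have hJc := J_cont b J hJ
  refine Integrable.mono' ((gauge_int (q + 2) hQ (by omega) R hR).const_mul C) ?_ ?_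
  · have h1 : Measurable (fun g : V₁ × V₂ => fderiv ℝ φ g (J g.2 g.1, 0)) :=
      (hcont.clm_apply (hJc.prodMk continuous_const)).measurable
    exact (Measurable.mul (by fun_prop) h1).aestronglyMeasurable
  filter_upwards [ae_ne_zero] with g hg
  have hN := Ng_pos hg
  by_cases h : Ng g < R
  · rw [Set.indicator_of_mem (by exact h)]
    have h1 := norm_fst_le_Ng g
    have h2 := norm_snd_le_Ng g
    have h3 : ‖((J g.2 g.1, 0) : V₁ × V₂)‖ ≤ Ng g ^ 2 * Ng g := by
      rw [Prod.norm_def, hH]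
      simp only [norm_zero, sup_le_iff]
      constructor
      · gcongr; linarith [norm_nonneg g.2]
      · positivity
    have h5 := (fderiv ℝ φ g).le_opNorm (J g.2 g.1, 0)
    rw [norm_mul, Real.norm_of_nonneg (by positivity : 0 ≤ ‖g.1‖ ^ q * (Ng g ^ (2 * (q + 2)))⁻¹)]
    calc _ ≤ Ng g ^ q * (Ng g ^ (2 * (q + 2)))⁻¹ * (C * (Ng g ^ 2 * Ng g)) := by
          gcongr
          exact h5.trans (by gcongr; exact (hb g).1)
      _ = _ := by field_simp; ring
  · rw [Set.indicator_of_notMem (by exact h)]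
    simp [((hb g).2 (not_lt.mp h)).2]

lemma omega_pos [Nontrivial V₁] (Q : ℕ) :
    0 < ∫ g in {g : V₁ × V₂ | Ng g < 1}, (‖g.1‖ / Ng g) ^ Q := by
  have hNm : Measurable (Ng : V₁ × V₂ → ℝ) := Ng_cont.measurable
  rw [setIntegral_pos_iff_support_of_nonneg_ae]
  · have ho : IsOpen ({g : V₁ × V₂ | g.1 ≠ 0} ∩ {g : V₁ × V₂ | Ng g < 1}) :=
      (isOpen_ne_fun continuous_fst continuous_const).inter ball_open
    have hne : ({g : V₁ × V₂ | g.1 ≠ 0} ∩ {g : V₁ × V₂ | Ng g < 1}).Nonempty := by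
      obtain ⟨z, hz⟩ := exists_ne (0 : V₁)
      have hN : Ng ((z, 0) : V₁ × V₂) > 0 := Ng_pos (fun h => hz (congrArg Prod.fst h))
      refine ⟨dil ((2 * Ng ((z, 0) : V₁ × V₂))⁻¹) (z, 0), ?_, ?_⟩
      · simp [dil, hz, hN.ne']
      · simp only [Set.mem_ofPred_eq, Ng_dil]
        rw [abs_of_pos (by positivity)]
        field_simp
        norm_num
    refine (ho.measure_pos volume hne).trans_le (measure_mono ?_)
    rintro g ⟨h1, h2⟩
    refine ⟨?_, h2⟩
    have h1' : g.1 ≠ 0 := h1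
    have hN : 0 < Ng g := Ng_pos (fun h => h1' (congrArg Prod.fst h))
    have := norm_pos_iff.mpr h1'
    have h3 : 0 < (‖g.1‖ / Ng g) ^ Q := by positivity
    exact h3.ne'
  · exact Filter.Eventually.of_forall fun g => pow_nonneg (div_nonneg (norm_nonneg _) (Ng_nonneg _)) _
  · refine Integrable.mono' (g := fun _ => (1 : ℝ)) (integrableOn_const vol_ball_lt_top.ne) ?_ ?_
    · exact (Measurable.pow_const (by fun_prop) _).aestronglyMeasurable
    · refine Filter.Eventually.of_forall fun g => ?_
      have h0 : 0 ≤ ‖g.1‖ / Ng g := div_nonneg (norm_nonneg _) (Ng_nonneg _)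
      rw [Real.norm_of_nonneg (by positivity)]
      exact pow_le_one₀ h0 (div_le_one_of_le₀ (norm_fst_le_Ng g) (Ng_nonneg g))

end aux

theorem riesz_htype_Q_fundamental_solution {V₁ V₂ : Type*} [NormedAddCommGroup V₁] [InnerProductSpace ℝ V₁]
    [FiniteDimensional ℝ V₁] [NormedAddCommGroup V₂] [InnerProductSpace ℝ V₂]
    [FiniteDimensional ℝ V₂] (m k : ℕ) (hm : 1 ≤ m) (hk : 1 ≤ k)
    (hdV₁ : Module.finrank ℝ V₁ = m) (hdV₂ : Module.finrank ℝ V₂ = k)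
    (b : V₁ →ₗ[ℝ] V₁ →ₗ[ℝ] V₂) (hskew : ∀ z z' : V₁, b z z' = - b z' z)
    (J : V₂ → V₁ →ₗ[ℝ] V₁) (hJ : ∀ (t : V₂) (z z' : V₁), ⟪J t z, z'⟫ = ⟪b z z', t⟫) (hH : ∀ (t : V₂) (z : V₁), ‖J t z‖ = ‖t‖ * ‖z‖) [MeasurableSpace V₁] [BorelSpace V₁] [MeasurableSpace V₂] [BorelSpace V₂]
    (ω σ : ℝ)
    (hω : ω = ∫ g in {g : V₁ × V₂ | Ng g < 1}, ‖Xgrad b Ng g‖ ^ ((m : ℝ) + 2 * k))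
    (hσ : σ = ((m : ℝ) + 2 * k) * ω)
    (ΓQ : V₁ × V₂ → ℝ)
    (hΓ : ∀ g : V₁ × V₂, g ≠ (0, 0) →
      ΓQ g = -(σ ^ (-(1 / (((m : ℝ) + 2 * k) - 1)))) * Real.log (Ng g)) :
    ∀ φ : V₁ × V₂ → ℝ, ContDiff ℝ (⊤ : ℕ∞) φ → HasCompactSupport φ →
      (∫ g : V₁ × V₂,
        ‖Xgrad b ΓQ g‖ ^ (((m : ℝ) + 2 * k) - 2) * ⟪Xgrad b ΓQ g, Xgrad b φ g⟫) = φ (0, 0) := by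
  intro φ hφ hc
  have hnt : Nontrivial V₁ := Module.nontrivial_of_finrank_pos (R := ℝ) (by omega)
  obtain ⟨q, hq⟩ : ∃ q, m + 2 * k = q + 2 := ⟨m + 2 * k - 2, by omega⟩
  have hQc : (m : ℝ) + 2 * k = ((q + 2 : ℕ) : ℝ) := by rw [← hq]; push_cast; ring
  have hQf : q + 2 = Module.finrank ℝ V₁ + 2 * Module.finrank ℝ V₂ := by rw [hdV₁, hdV₂, hq]
  have hNm : Measurable (Ng : V₁ × V₂ → ℝ) := Ng_cont.measurable
  have hω' : ω = ∫ g in {g : V₁ × V₂ | Ng g < 1}, (‖g.1‖ / Ng g) ^ (q + 2) := by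
    rw [hω, hQc]
    refine integral_congr_ae (ae_restrict_of_ae ?_)
    filter_upwards [ae_ne_zero] with g hg
    rw [Real.rpow_natCast, Xgrad_Ng b hskew J hJ hH g hg]
  have hωpos : 0 < ω := by rw [hω']; exact omega_pos _
  have hσpos : 0 < σ := by rw [hσ, hQc]; positivity
  obtain ⟨c, hcdef⟩ : ∃ c, c = σ ^ (-(1 / (((m : ℝ) + 2 * k) - 1))) := ⟨_, rfl⟩
  have hcpos : 0 < c := by rw [hcdef]; exact Real.rpow_pos_of_pos hσpos _
  have hcσ : c ^ (q + 1) = σ⁻¹ := by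
    rw [hcdef, hQc, ← Real.rpow_natCast, ← Real.rpow_mul hσpos.le, ← Real.rpow_neg_one]
    congr 1
    push_cast
    have : (q : ℝ) + 2 - 1 ≠ 0 := by
      have : (0 : ℝ) ≤ q := by positivity
      linarith
    field_simp
    ring
  rw [← hcdef] at hΓ
  obtain ⟨hI1, hE1⟩ := dil_main (q + 2) hQf (by omega) φ hφ hc
    (fun g : V₁ × V₂ => (‖g.1‖ / Ng g) ^ (q + 2)) (by fun_prop)
    (fun r hr g => by
      simp only [Ng_dil]
      simp only [dil, norm_smul, Real.norm_eq_abs]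
      rw [mul_div_mul_left _ _ (abs_pos.mpr hr.ne').ne'])
    (fun g => by
      have h0 : 0 ≤ ‖g.1‖ / Ng g := div_nonneg (norm_nonneg _) (Ng_nonneg _)
      rw [abs_of_nonneg (by positivity)]
      exact pow_le_one₀ h0 (div_le_one_of_le₀ (norm_fst_le_Ng g) (Ng_nonneg g)))
  have hI2 := rot_integrable b J hJ hH φ hφ hc q hQf
  have hE2 := rot_int b hskew J hJ hH φ hφ hc q hI2
  have hint : ∀ᵐ g : V₁ × V₂, ‖Xgrad b ΓQ g‖ ^ (((m : ℝ) + 2 * k) - 2) * ⟪Xgrad b ΓQ g, Xgrad b φ g⟫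
      = - c ^ (q + 1) * ((‖g.1‖ / Ng g) ^ (q + 2) * Zf φ g * (Ng g ^ (q + 2))⁻¹ +
        4 * (‖g.1‖ ^ q * (Ng g ^ (2 * (q + 2)))⁻¹ * fderiv ℝ φ g (J g.2 g.1, 0))) := by
    filter_upwards [ae_ne_zero] with g hg
    have hN := Ng_pos hg
    have e : ((m : ℝ) + 2 * k) - 2 = (q : ℝ) := by rw [hQc]; push_cast; ring
    rw [e, Real.rpow_natCast, Xgrad_log b J hJ c ΓQ hΓ g hg, norm_smul, norm_Ag b hskew J hJ hH,
      inner_smul_left, inner_Ag b hskew J hJ hH, neg_mul, norm_neg,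
      Real.norm_of_nonneg (by positivity)]
    have e2 : c * (Ng g ^ 4)⁻¹ * (‖g.1‖ * Ng g ^ 2) = c * ‖g.1‖ / Ng g ^ 2 := by field_simp
    rw [e2, div_pow, mul_pow, div_pow]
    simp only [map_neg, conj_trivial]
    field_simp
    ring
  rw [integral_congr_ae hint, integral_const_mul, integral_add hI1 (hI2.const_mul 4),
    integral_const_mul, hE1, hE2, hcσ, ← hω', ← hQc, ← hσ]
  field_simp
  ring
end
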